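/- arXiv:1701.05965 — 7 statements merged into one kernel-verified Lean document; each statement's English description precedes it below -/
import Mathlib

section
/- Let m ≥ 6 with m ≡ 2 (mod 4), and let e be an integer with 2 ≤ e ≤ m/2 and gcd(m,e) = 2. Then for every 2-element subset {x,y} of F = GF(2^m) there is exactly one 4-element subset B of F with {x,y} ⊆ B, ∑_{g∈B} g = 0 and ∑_{g∈B} g^{2^e+1} = 0. In other words, the 4-element subsets B of F satisfying ∑_{g∈B} g = 0 and ∑_{g∈B} g^{2^e+1} = 0 are the blocks of a Steiner system S(2, 4, 2^m) on the point set F. -/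
/-- In a finite field of order `2 ^ m` with `gcd m e = 2`, the fixed points of `t ↦ t ^ 2 ^ e`
are fixed by `t ↦ t ^ 4`. -/
theorem pow_four_eq_self_of_pow_two_pow_eq_self {F : Type*} [Field F] [Fintype F] {m e : ℕ}
    (hF : Fintype.card F = 2 ^ m) (hgcd : Nat.gcd m e = 2) {t : F} (ht : t ^ 2 ^ e = t) :
    t ^ 4 = t := by
  have iter : ∀ n, (fun s : F => s ^ 2)^[n] t = t ^ 2 ^ n := fun n => by
    rw [pow_iterate]
  have h₁ : Function.IsPeriodicPt (fun s : F => s ^ 2) m t := by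
    rw [Function.IsPeriodicPt, Function.IsFixedPt, iter, ← hF, FiniteField.pow_card]
  have h₂ : Function.IsPeriodicPt (fun s : F => s ^ 2) e t := by
    rw [Function.IsPeriodicPt, Function.IsFixedPt, iter, ht]
  have h := h₁.gcd h₂
  rw [hgcd, Function.IsPeriodicPt, Function.IsFixedPt, iter] at h
  exact h

/-- A finite field of order `2 ^ m` with `m` even contains a primitive cube root of unity. -/
theorem exists_sq_add_self_add_one_eq_zero {F : Type*} [Field F] [Fintype F] {m : ℕ}
    (hF : Fintype.card F = 2 ^ m) (hm : Even m) : ∃ ω : F, ω ^ 2 + ω + 1 = 0 := by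
  classical
  have : Fact (Nat.Prime 3) := ⟨Nat.prime_three⟩
  obtain ⟨k, rfl⟩ := hm
  have hdvd : 3 ∣ Fintype.card Fˣ := by
    rw [Fintype.card_units, hF, ← two_mul, pow_mul]
    simpa using Nat.sub_dvd_pow_sub_pow 4 1 k
  obtain ⟨g, hg⟩ := exists_prime_orderOf_dvd_card 3 hdvd
  have h3 : (g : F) ^ 3 = 1 := by
    rw [← Units.val_pow_eq_pow_val, ← hg, pow_orderOf_eq_one, Units.val_one]
  have h1 : (g : F) - 1 ≠ 0 := fun h => by
    rw [sub_eq_zero, Units.val_eq_one] at h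
    simp [h] at hg
  exact ⟨g, mul_left_cancel₀ h1 (by linear_combination h3)⟩

theorem pow_two_pow_eq_self_of_even {R : Type*} [Monoid R] {a : R} (ha : a ^ 4 = a) {e : ℕ}
    (he : Even e) : a ^ 2 ^ e = a := by
  obtain ⟨k, rfl⟩ := he
  rw [← two_mul, pow_mul]
  induction k with
  | zero => simp
  | succ k ih => rw [pow_succ, pow_mul, ih]; exact ha

/-- In characteristic two, four elements summing to zero satisfy
`∑ g ^ (2 ^ e + 1) = (x + y) ^ 2 ^ e * (x + z) + (x + y) * (x + z) ^ 2 ^ e`. -/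
theorem sum_pow_two_pow_add_one {R : Type*} [CommRing R] [CharP R 2] (e : ℕ) {x y z w : R}
    (h : x + y + z + w = 0) :
    x ^ (2 ^ e + 1) + y ^ (2 ^ e + 1) + z ^ (2 ^ e + 1) + w ^ (2 ^ e + 1) =
      (x + y) ^ 2 ^ e * (x + z) + (x + y) * (x + z) ^ 2 ^ e := by
  have h2 : (2 : R) = 0 := CharTwo.two_eq_zero
  have hw : w = x + y + z := by linear_combination h - (x + y + z) * h2
  subst hw
  simp only [pow_succ, add_pow_char_pow]
  linear_combination (y ^ 2 ^ e * y + z ^ 2 ^ e * z) * h2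

/-- The 4-element subsets `B` of `F = GF(2^m)` with `∑_{g∈B} g = 0` and
`∑_{g∈B} g^{2^e+1} = 0` form the blocks of a Steiner system `S(2,4,2^m)`:
every 2-element subset `{x,y}` of `F` is contained in exactly one such `B`. -/
theorem steiner_system_S_2_4_2m (m : ℕ) (hm6 : 6 ≤ m) (hm4 : m % 4 = 2)
    (e : ℕ) (he2 : 2 ≤ e) (hem : 2 * e ≤ m) (hgcd : Nat.gcd m e = 2)
    (F : Type) [Field F] [Fintype F] (hF : Fintype.card F = 2 ^ m)
    (x y : F) (hxy : x ≠ y) :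
    ∃! B : Finset F, B.card = 4 ∧ x ∈ B ∧ y ∈ B ∧
      (∑ g ∈ B, g = 0) ∧ (∑ g ∈ B, g ^ (2 ^ e + 1) = 0) := by
  classical
  have hchar : CharP F 2 := charP_of_card_eq_prime_pow hF
  have h2 : (2 : F) = 0 := CharTwo.two_eq_zero
  have heven : Even e := even_iff_two_dvd.2 (hgcd ▸ Nat.gcd_dvd_right m e)
  obtain ⟨ω, hω⟩ := exists_sq_add_self_add_one_eq_zero hF
    (even_iff_two_dvd.2 (hgcd ▸ Nat.gcd_dvd_left m e))
  have hu : x + y ≠ 0 := fun h => hxy (CharTwo.add_eq_zero.1 h)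
  have hω0 : ω ≠ 0 := by rintro rfl; simp at hω
  have hω1 : ω + 1 ≠ 0 := fun h => by
    have : (1 : F) = 0 := by linear_combination hω - ω * h
    exact one_ne_zero this
  have hωe : ω ^ 2 ^ e = ω :=
    pow_two_pow_eq_self_of_even (by linear_combination (ω ^ 2 - ω) * hω) heven
  have hxz : x ≠ x + ω * (x + y) := by simpa using ⟨hω0, hu⟩
  have hxw : x ≠ x + (ω + 1) * (x + y) := by simpa using ⟨hω1, hu⟩
  have hyz : y ≠ x + ω * (x + y) := fun h =>
    mul_ne_zero hω1 hu (by linear_combination -h + y * h2)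
  have hyw : y ≠ x + (ω + 1) * (x + y) := fun h =>
    mul_ne_zero hω0 hu (by linear_combination -h - x * h2)
  have hzw : x + ω * (x + y) ≠ x + (ω + 1) * (x + y) := fun h =>
    hu (by linear_combination -h)
  have sum_four : ∀ {z w : F} (f : F → F), x ≠ z → x ≠ w → y ≠ z → y ≠ w → z ≠ w →
      ∑ g ∈ ({x, y, z, w} : Finset F), f g = f x + f y + f z + f w := by
    intro z w f h₁ h₂ h₃ h₄ h₅
    rw [Finset.sum_insert (by simp [*]), Finset.sum_insert (by simp [*]),
      Finset.sum_insert (by simp [*]), Finset.sum_singleton]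
    ring
  refine ⟨{x, y, x + ω * (x + y), x + (ω + 1) * (x + y)}, ⟨?_, by simp, by simp, ?_, ?_⟩, ?_⟩
  · rw [Finset.card_insert_of_notMem (by simp [*]), Finset.card_insert_of_notMem (by simp [*]),
      Finset.card_pair hzw]
  · rw [sum_four _ hxz hxw hyz hyw hzw]
    linear_combination (2 * x + y + ω * (x + y)) * h2
  · rw [sum_four _ hxz hxw hyz hyw hzw, sum_pow_two_pow_add_one e
      (by linear_combination (2 * x + y + ω * (x + y)) * h2),
      ← add_assoc, CharTwo.add_self_eq_zero, zero_add, mul_pow, hωe]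
    linear_combination (ω * (x + y) * (x + y) ^ 2 ^ e) * h2
  · rintro B ⟨hcard, hxB, hyB, hsum, hpow⟩
    have hyB' : y ∈ B.erase x := Finset.mem_erase.2 ⟨hxy.symm, hyB⟩
    obtain ⟨z, w, hne, hzwB⟩ : ∃ z w, z ≠ w ∧ (B.erase x).erase y = {z, w} :=
      Finset.card_eq_two.1 (by
        rw [Finset.card_erase_of_mem hyB', Finset.card_erase_of_mem hxB, hcard])
    have hB : B = {x, y, z, w} := by
      rw [← hzwB, Finset.insert_erase hyB', Finset.insert_erase hxB]
    have hz : z ∈ (B.erase x).erase y := by simp [hzwB]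
    have hw : w ∈ (B.erase x).erase y := by simp [hzwB]
    simp only [Finset.mem_erase] at hz hw
    have four := fun f => sum_four f hz.2.1.symm hw.2.1.symm hz.1.symm hw.1.symm hne
    rw [hB, four] at hsum hpow
    rw [sum_pow_two_pow_add_one e hsum] at hpow
    obtain ⟨t, ht⟩ : ∃ t, x + z = t * (x + y) := ⟨(x + z) / (x + y), by field_simp⟩
    have hz' : z = x + t * (x + y) := by linear_combination ht - x * h2
    have hw' : w = x + (t + 1) * (x + y) := by
      linear_combination hsum - ht - (x + y + t * (x + y)) * h2
    have hte : t ^ 2 ^ e = t := by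
      rw [ht, mul_pow] at hpow
      have : (x + y) ^ 2 ^ e * (x + y) * (t ^ 2 ^ e + t) = 0 := by linear_combination hpow
      exact CharTwo.add_eq_zero.1
        ((mul_eq_zero.1 this).resolve_left (mul_ne_zero (pow_ne_zero _ hu) hu))
    have ht4 := pow_four_eq_self_of_pow_two_pow_eq_self hF hgcd hte
    have ht0 : t ≠ 0 := by rintro rfl; exact hz.2.1 (by simpa using hz')
    have ht1 : t - 1 ≠ 0 := fun h => hz.1 (by linear_combination hz' + (x + y) * h + x * h2)
    have htω : (t - ω) * (t - (ω + 1)) = 0 :=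
      mul_left_cancel₀ (mul_ne_zero ht0 ht1)
        (by linear_combination ht4 + t * (t - 1) * (hω - (t * (ω + 1) + 1) * h2))
    rw [hB, hz', hw']
    rcases mul_eq_zero.1 htω with h | h
    · rw [sub_eq_zero.1 h]
    · rw [sub_eq_zero.1 h, add_assoc ω, CharTwo.add_self_eq_zero, add_zero,
        Finset.pair_comm]
end

section
/- Let m ≥ 6 with m ≡ 2 (mod 4), and let e be an integer with 2 ≤ e ≤ m/2 and gcd(m,e) = 2. Then the number of 4-element subsets B of F = GF(2^m) with ∑_{g∈B} g = 0 and ∑_{g∈B} g^{2^e+1} = 0 equals 2^{m−1}(2^m−1)/6. -/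
lemma sq_add_self_add_one_eq_zero {F : Type*} [Field F] {t : F} (h3 : t ^ 3 = 1) (h1 : t ≠ 1) :
    t ^ 2 + t + 1 = 0 := by
  refine (mul_eq_zero.mp ?_).resolve_left (sub_ne_zero.mpr h1)
  linear_combination h3

/-- Powers `2 ^ e` with `e` even fix the cube roots of unity. -/
lemma pow_two_pow_eq_self_of_even_s1 {F : Type*} [Field F] {w : F} (h3 : w ^ 3 = 1) {e : ℕ} (he : Even e) :
    w ^ 2 ^ e = w := by
  obtain ⟨k, rfl⟩ := he
  induction k with
  | zero => simp
  | succ k ih =>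
    rw [show k + 1 + (k + 1) = k + k + 2 by ring, pow_add, pow_mul, ih]
    linear_combination w * h3

section CharTwo

variable {F : Type*} [Field F] [CharP F 2]

/-- The second derivative of `x ↦ x ^ (2 ^ e + 1)` in characteristic two. -/
lemma pow_two_pow_add_one_add_eq (e : ℕ) (x y z : F) :
    x ^ (2 ^ e + 1) + y ^ (2 ^ e + 1) + z ^ (2 ^ e + 1) + (x + y + z) ^ (2 ^ e + 1) =
      (x + y) ^ 2 ^ e * (x + z) + (x + y) * (x + z) ^ 2 ^ e := by
  have h2 : (2 : F) = 0 := CharTwo.two_eq_zero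
  simp only [pow_succ _ (2 ^ e), add_pow_char_pow]
  generalize x ^ 2 ^ e = X
  generalize y ^ 2 ^ e = Y
  generalize z ^ 2 ^ e = Z
  linear_combination (Y * y + Z * z) * h2

lemma eq_or_eq_add_one_of_sq_add_self_add_one {w t : F} (hw : w ^ 2 + w + 1 = 0)
    (ht : t ^ 2 + t + 1 = 0) : t = w ∨ t = w + 1 := by
  have h2 : (2 : F) = 0 := CharTwo.two_eq_zero
  have h : (t - w) * (t - (w + 1)) = 0 := by
    linear_combination ht - hw + (w ^ 2 + w - t * w - t) * h2
  rcases mul_eq_zero.mp h with h | h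
  · exact Or.inl (sub_eq_zero.mp h)
  · exact Or.inr (sub_eq_zero.mp h)

variable [DecidableEq F]

/-- The affine line over `{0, 1, w, w + 1}` through `x` and `y`. -/
def lineThrough (w x y : F) : Finset F :=
  {x, y, x + w * (x + y), y + w * (x + y)}

lemma lineThrough_spec {w : F} (hw : w ^ 2 + w + 1 = 0) {e : ℕ} (he : Even e) {x y : F}
    (hxy : x ≠ y) :
    (lineThrough w x y).card = 4 ∧ ∑ g ∈ lineThrough w x y, g = 0 ∧
      ∑ g ∈ lineThrough w x y, g ^ (2 ^ e + 1) = 0 := by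
  have h2 : (2 : F) = 0 := CharTwo.two_eq_zero
  have ha : x + y ≠ 0 := fun h => hxy (CharTwo.add_eq_zero.mp h)
  have hw0 : w ≠ 0 := by rintro rfl; simp at hw
  have hw1 : w + 1 ≠ 0 := fun h => one_ne_zero (α := F) (by linear_combination hw - w * h)
  have hwa : w * (x + y) ≠ 0 := mul_ne_zero hw0 ha
  have hwa' : (w + 1) * (x + y) ≠ 0 := mul_ne_zero hw1 ha
  have h1 : x ∉ ({y, x + w * (x + y), y + w * (x + y)} : Finset F) := by
    simp only [Finset.mem_insert, Finset.mem_singleton, not_or]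
    refine ⟨hxy, fun h => hwa ?_, fun h => hwa' ?_⟩
    · linear_combination -h
    · linear_combination -h + x * h2
  have h3 : y ∉ ({x + w * (x + y), y + w * (x + y)} : Finset F) := by
    simp only [Finset.mem_insert, Finset.mem_singleton, not_or]
    refine ⟨fun h => hwa' ?_, fun h => hwa ?_⟩
    · linear_combination -h + y * h2
    · linear_combination -h
  have h4 : x + w * (x + y) ∉ ({y + w * (x + y)} : Finset F) := by
    simpa using hxy
  have hlast : y + w * (x + y) = x + y + (x + w * (x + y)) := by
    linear_combination -x * h2
  have hw3 : w ^ 3 = 1 := by linear_combination (w - 1) * hw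
  refine ⟨?_, ?_, ?_⟩
  · rw [lineThrough, Finset.card_insert_of_notMem h1, Finset.card_insert_of_notMem h3,
      Finset.card_insert_of_notMem h4, Finset.card_singleton]
  · rw [lineThrough, Finset.sum_insert h1, Finset.sum_insert h3, Finset.sum_insert h4,
      Finset.sum_singleton]
    linear_combination (x + y + w * (x + y)) * h2
  · rw [lineThrough, Finset.sum_insert h1, Finset.sum_insert h3, Finset.sum_insert h4,
      Finset.sum_singleton, hlast, ← add_assoc, ← add_assoc, pow_two_pow_add_one_add_eq]
    have hxz : x + (x + w * (x + y)) = w * (x + y) := by linear_combination x * h2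
    rw [hxz, mul_pow, pow_two_pow_eq_self_of_even_s1 hw3 he]
    linear_combination (x + y) ^ 2 ^ e * w * (x + y) * h2

lemma eq_lineThrough {w : F} (hw : w ^ 2 + w + 1 = 0) {e : ℕ}
    (hcube : ∀ t : F, t ≠ 0 → t ^ 2 ^ e = t → t ^ 3 = 1) {B : Finset F} (hB : B.card = 4)
    (hsum : ∑ g ∈ B, g = 0) (hpow : ∑ g ∈ B, g ^ (2 ^ e + 1) = 0) {x y : F}
    (hx : x ∈ B) (hy : y ∈ B) (hxy : x ≠ y) : B = lineThrough w x y := by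
  have h2 : (2 : F) = 0 := CharTwo.two_eq_zero
  have ha : x + y ≠ 0 := fun h => hxy (CharTwo.add_eq_zero.mp h)
  suffices hsub : B ⊆ lineThrough w x y from
    Finset.eq_of_subset_of_card_le hsub
      ((lineThrough_spec hw Even.zero hxy).1.trans hB.symm).le
  intro z hz
  by_cases hzx : z = x
  · simp [lineThrough, hzx]
  by_cases hzy : z = y
  · simp [lineThrough, hzy]
  have hyB : y ∈ B.erase x := Finset.mem_erase.mpr ⟨hxy.symm, hy⟩
  have hzB : z ∈ (B.erase x).erase y :=
    Finset.mem_erase.mpr ⟨hzy, Finset.mem_erase.mpr ⟨hzx, hz⟩⟩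
  have hcard : (((B.erase x).erase y).erase z).card = 1 := by
    rw [Finset.card_erase_of_mem hzB, Finset.card_erase_of_mem hyB,
      Finset.card_erase_of_mem hx, hB]
  obtain ⟨u, hu⟩ := Finset.card_eq_one.mp hcard
  have expand (f : F → F) : ∑ g ∈ B, f g = f x + (f y + (f z + f u)) := by
    rw [← Finset.add_sum_erase B f hx, ← Finset.add_sum_erase _ f hyB,
      ← Finset.add_sum_erase _ f hzB, hu, Finset.sum_singleton]
  rw [expand] at hsum hpow
  have hu' : u = x + y + z := by linear_combination hsum - (x + y + z) * h2
  rw [hu', ← add_assoc, ← add_assoc, pow_two_pow_add_one_add_eq] at hpow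
  obtain ⟨t, ht⟩ : ∃ t, x + z = t * (x + y) := ⟨(x + z) / (x + y), by field_simp⟩
  have hz' : z = x + t * (x + y) := by linear_combination ht - x * h2
  have ht0 : t ≠ 0 := by rintro rfl; simp at hz'; exact hzx hz'
  have ht1 : t ≠ 1 := by
    rintro rfl
    exact hzy (by linear_combination hz' + x * h2)
  have htq : t ^ 2 ^ e = t := by
    rw [ht, mul_pow] at hpow
    have : (x + y) ^ 2 ^ e * (x + y) * (t + t ^ 2 ^ e) = 0 := by linear_combination hpow
    have := (mul_eq_zero.mp this).resolve_left (mul_ne_zero (pow_ne_zero _ ha) ha)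
    exact (CharTwo.add_eq_zero.mp this).symm
  have htt := sq_add_self_add_one_eq_zero (hcube t ht0 htq) ht1
  rcases eq_or_eq_add_one_of_sq_add_self_add_one hw htt with rfl | rfl
  · simp [lineThrough, hz']
  · have : z = y + w * (x + y) := by linear_combination hz' + x * h2
    simp [lineThrough, this]

end CharTwo

/-- A family of `k`-subsets such that any two distinct points lie in exactly one of them. -/
lemma card_mul_eq_of_existsUnique_block {α : Type*} [Fintype α] [DecidableEq α] {k : ℕ}
    (S : Finset (Finset α)) (hk : ∀ B ∈ S, B.card = k)
    (hS : ∀ x y, x ≠ y → ∃! B, B ∈ S ∧ x ∈ B ∧ y ∈ B) :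
    S.card * (k * k - k) = Fintype.card α * Fintype.card α - Fintype.card α := by
  have hunion : S.biUnion Finset.offDiag = (Finset.univ : Finset α).offDiag := by
    ext ⟨x, y⟩
    simp only [Finset.mem_biUnion, Finset.mem_offDiag, Finset.mem_univ, true_and]
    refine ⟨fun ⟨B, _, _, _, h⟩ => h, fun h => ?_⟩
    obtain ⟨B, ⟨hB, hx, hy⟩, _⟩ := hS x y h
    exact ⟨B, hB, hx, hy, h⟩
  have hdisj : (S : Set (Finset α)).PairwiseDisjoint Finset.offDiag := by
    intro B hB C hC hBC
    refine Finset.disjoint_left.mpr ?_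
    rintro ⟨x, y⟩ h h'
    rw [Finset.mem_offDiag] at h h'
    exact hBC ((hS x y h.2.2).unique ⟨hB, h.1, h.2.1⟩ ⟨hC, h'.1, h'.2.1⟩)
  have hcard := Finset.card_biUnion hdisj
  rw [hunion, Finset.offDiag_card, Finset.card_univ,
    Finset.sum_congr rfl (fun B hB => by rw [Finset.offDiag_card, hk B hB]),
    Finset.sum_const, smul_eq_mul] at hcard
  exact hcard.symm

/-- The number of 4-element subsets `B` of `F = GF(2^m)` with `∑_{g∈B} g = 0` and
`∑_{g∈B} g^{2^e+1} = 0` equals `2^{m-1}(2^m-1)/6`. -/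
theorem card_weight4_supports (m : ℕ) (hm6 : 6 ≤ m) (hm4 : m % 4 = 2)
    (e : ℕ) (he2 : 2 ≤ e) (hem : 2 * e ≤ m) (hgcd : Nat.gcd m e = 2)
    (F : Type) [Field F] [Fintype F] (hF : Fintype.card F = 2 ^ m) :
    Nat.card {B : Finset F // B.card = 4 ∧
        (∑ g ∈ B, g = 0) ∧ (∑ g ∈ B, g ^ (2 ^ e + 1) = 0)} =
      2 ^ (m - 1) * (2 ^ m - 1) / 6 := by
  classical
  have hm_pos : m ≠ 0 := by omega
  have h2 : (2 : F) = 0 := by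
    have h := Nat.cast_card_eq_zero F
    rw [hF, Nat.cast_pow] at h
    exact_mod_cast pow_eq_zero_iff hm_pos |>.mp h
  have : CharP F 2 := CharTwo.of_one_ne_zero_of_two_eq_zero one_ne_zero h2
  have he : Even e := even_iff_two_dvd.mpr (hgcd ▸ Nat.gcd_dvd_right m e)
  have hdvd : 3 ∣ 2 ^ m - 1 := by
    have := Nat.pow_sub_one_dvd_pow_sub_one 2 (hgcd ▸ Nat.gcd_dvd_left m e : 2 ∣ m)
    simpa using this
  have hcube : ∀ t : F, t ≠ 0 → t ^ 2 ^ e = t → t ^ 3 = 1 := by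
    intro t ht htq
    have h1 : t ^ (2 ^ m - 1) = 1 := hF ▸ FiniteField.pow_card_sub_one_eq_one t ht
    have h2 : t ^ (2 ^ e - 1) = 1 := by
      refine mul_right_cancel₀ ht ?_
      rw [pow_sub_one_mul (by positivity), htq, one_mul]
    have h3 := pow_gcd_eq_one.mpr ⟨h1, h2⟩
    rwa [Nat.pow_sub_one_gcd_pow_sub_one, hgcd] at h3
  obtain ⟨w, hw⟩ : ∃ w : F, w ^ 2 + w + 1 = 0 := by
    have : Fact (Nat.Prime 3) := ⟨Nat.prime_three⟩
    obtain ⟨u, hu⟩ := exists_prime_orderOf_dvd_card (G := Fˣ) 3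
      (by rwa [Fintype.card_units, hF])
    refine ⟨u, sq_add_self_add_one_eq_zero ?_ ?_⟩
    · rw [← Units.val_pow_eq_pow_val, ← hu, pow_orderOf_eq_one, Units.val_one]
    · intro h
      rw [Units.val_eq_one] at h
      simp [h] at hu
  have key := card_mul_eq_of_existsUnique_block (k := 4)
    (Finset.univ.filter fun B : Finset F => B.card = 4 ∧
        (∑ g ∈ B, g = 0) ∧ (∑ g ∈ B, g ^ (2 ^ e + 1) = 0))
    (fun B hB => (Finset.mem_filter.mp hB).2.1)
    (fun x y hxy => by
      refine ⟨lineThrough w x y, ⟨?_, ?_, ?_⟩, ?_⟩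
      · simpa using lineThrough_spec hw he hxy
      · simp [lineThrough]
      · simp [lineThrough]
      · rintro B ⟨hB, hx, hy⟩
        obtain ⟨-, h4, hs, hp⟩ := Finset.mem_filter.mp hB
        exact eq_lineThrough hw hcube h4 hs hp hx hy hxy)
  rw [Nat.card_eq_fintype_card, Fintype.card_subtype]
  rw [hF, ← Nat.mul_sub_one (2 ^ m)] at key
  obtain ⟨n, rfl⟩ := Nat.exists_eq_succ_of_ne_zero hm_pos
  rw [Nat.succ_eq_add_one, pow_succ' 2 n, mul_assoc] at key
  rw [Nat.succ_eq_add_one, Nat.add_sub_cancel, pow_succ' 2 n]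
  omega
end

section
/- Let m ≥ 6 with m ≡ 2 (mod 4), and let e be an integer with 2 ≤ e ≤ m/2 and gcd(m,e) = 2. Then for every 2-element subset {x,y} of F = GF(2^m), the number of 6-element subsets B of F with {x,y} ⊆ B, ∑_{g∈B} g = 0 and ∑_{g∈B} g^{2^e+1} = 0 equals (2^m−4)(2^m−24)/24. In other words, these 6-element subsets form a 2-(2^m, 6, (2^m−4)(2^m−24)/24) design on the point set F. -/
theorem card_zero_one_self_succ {F : Type} [Field F] [DecidableEq F] (h2 : (2 : F) = 0)
    (u : F) (h0 : u ≠ 0) (h1 : u ≠ 1) :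
    ({0, 1, u, u + 1} : Finset F).card = 4 := by
  have : u + 1 ≠ 0 := by grind
  have : u ≠ u + 1 := by grind
  have : u + 1 ≠ 1 := by grind
  rw [Finset.card_insert_of_notMem (by grind), Finset.card_insert_of_notMem (by grind),
    Finset.card_pair (by assumption)]

section TwistedForm

variable {F : Type} [Field F] [Fintype F]

/-- The polarization `(a, b) ↦ σ a * b + a * σ b` of the map `z ↦ σ z * z`. -/
def twistedForm (σ : F →+* F) (a b : F) : F := σ a * b + a * σ b

/-- The additive map `(a, c) ↦ twistedForm σ a u + twistedForm σ c w`. -/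
def twistedPairing (σ : F →+* F) (u w : F) : F × F →+ F where
  toFun p := twistedForm σ p.1 u + twistedForm σ p.2 w
  map_zero' := by simp [twistedForm]
  map_add' p q := by simp only [twistedForm, Prod.fst_add, Prod.snd_add, map_add]; ring

theorem trace_ringHom_apply [Algebra (ZMod 2) F] (σ : F →+* F) (z : F) :
    Algebra.trace (ZMod 2) F (σ z) = Algebra.trace (ZMod 2) F z := by
  have hcomm : ∀ r : ZMod 2, σ (algebraMap (ZMod 2) F r) = algebraMap (ZMod 2) F r := fun r =>
    congrArg (fun g : ZMod 2 →+* F => g r)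
      (Subsingleton.elim (σ.comp (algebraMap (ZMod 2) F)) (algebraMap (ZMod 2) F))
  let τ : F →ₐ[ZMod 2] F := { σ with commutes' := hcomm }
  have hτ : Function.Bijective τ := Finite.injective_iff_bijective.mp σ.injective
  exact Algebra.trace_eq_of_algEquiv (AlgEquiv.ofBijective τ hτ) z

theorem eq_zero_of_trace_mul_eq_zero [Algebra (ZMod 2) F] (z : F)
    (h : ∀ a, Algebra.trace (ZMod 2) F (z * a) = 0) : z = 0 :=
  (traceForm_nondegenerate (ZMod 2) F).1 z h

/-- The kernel of the adjoint of `twistedForm σ · u` with respect to the trace form. -/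
theorem mul_eq_of_trace_mul_twistedForm_eq_zero [Algebra (ZMod 2) F] (h2 : (2 : F) = 0)
    (σ : F →+* F) (μ u : F)
    (h : ∀ a, Algebra.trace (ZMod 2) F (μ * twistedForm σ a u) = 0) :
    μ * u = σ μ * σ (σ u) := by
  have hz : μ * u + σ μ * σ (σ u) = 0 := by
    apply eq_zero_of_trace_mul_eq_zero
    intro b
    obtain ⟨a, rfl⟩ := (Finite.injective_iff_surjective.mp σ.injective) b
    rw [← h a, twistedForm, add_mul, mul_add, map_add, map_add,
      ← trace_ringHom_apply σ (μ * (a * σ u))]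
    simp only [map_mul]
    congr 2 <;> ring
  grind

theorem exists_trace_mul_eq [Algebra (ZMod 2) F] (φ : F →ₗ[ZMod 2] ZMod 2) :
    ∃ μ : F, ∀ a, φ a = Algebra.trace (ZMod 2) F (μ * a) := by
  obtain ⟨μ, hμ⟩ :=
    ((Algebra.traceForm (ZMod 2) F).toDual (traceForm_nondegenerate (ZMod 2) F)).surjective φ
  exact ⟨μ, fun a => by rw [← hμ]; rfl⟩

theorem twistedPairing_surjective [CharP F 2] (σ : F →+* F)
    (hσ : ∀ z, σ (σ z) = z → σ z = z) (u : F) (hu : σ u ≠ u) :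
    Function.Surjective (twistedPairing σ u (u + 1)) := by
  have h2 : (2 : F) = 0 := CharTwo.two_eq_zero
  let := ZMod.algebra F 2
  let L := (twistedPairing σ u (u + 1)).toZModLinearMap 2
  suffices L.range = ⊤ from LinearMap.range_eq_top.mp this
  by_contra hL
  obtain ⟨φ, hφ, hle⟩ := Submodule.exists_le_ker_of_lt_top _ (lt_top_iff_ne_top.mpr hL)
  obtain ⟨μ, hμ⟩ := exists_trace_mul_eq φ
  have hvan : ∀ a c, Algebra.trace (ZMod 2) F
      (μ * (twistedForm σ a u + twistedForm σ c (u + 1))) = 0 := fun a c => by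
    rw [← hμ]
    exact hle ⟨(a, c), rfl⟩
  have h₁ : μ * u = σ μ * σ (σ u) := mul_eq_of_trace_mul_twistedForm_eq_zero h2 σ μ u
    fun a => by simpa [twistedForm] using hvan a 0
  have h₂ : μ * (u + 1) = σ μ * σ (σ (u + 1)) :=
    mul_eq_of_trace_mul_twistedForm_eq_zero h2 σ μ (u + 1)
      fun a => by simpa [twistedForm] using hvan 0 a
  have hμ0 : μ ≠ 0 := by
    rintro rfl
    exact hφ (LinearMap.ext fun a => by simp [hμ])
  simp only [map_add, map_one] at h₂
  have h₃ : σ μ = μ := by linear_combination h₁ - h₂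
  rw [h₃] at h₁
  exact hu (hσ u (mul_left_cancel₀ hμ0 h₁).symm)

variable [DecidableEq F]

theorem card_fiber_of_surjective (L : F × F →+ F) (hL : Function.Surjective L) (b : F) :
    (Finset.univ.filter fun p => L p = b).card = Fintype.card F := by
  have h := Finset.card_eq_sum_card_fiberwise (f := L) (s := Finset.univ) (t := Finset.univ)
    (fun _ _ => by simp)
  rw [Finset.sum_congr rfl fun y _ =>
    AddMonoidHom.card_fiber_eq_of_mem_range L (hL y) (hL b)] at h
  simp only [Finset.card_univ, Fintype.card_prod, Finset.sum_const, smul_eq_mul] at h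
  exact (Nat.eq_of_mul_eq_mul_left Fintype.card_pos h).symm

theorem card_twistedForm_eq (σ : F →+* F) (h2 : (2 : F) = 0)
    (hK : (Finset.univ.filter fun z => σ z = z).card = 4) (v b : F) (hv : v ≠ 0) :
    (Finset.univ.filter fun c => twistedForm σ c v = twistedForm σ b v).card = 4 := by
  rw [← hK]
  have hσv : σ v ≠ 0 := (map_ne_zero σ).mpr hv
  refine Finset.card_bij' (fun c _ => (c + b) / v) (fun k _ => b + v * k) ?_ ?_ ?_ ?_
  · intro c hc
    simp only [Finset.mem_filter, Finset.mem_univ, true_and, twistedForm, map_div₀, map_add] at hc ⊢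
    rw [div_eq_div_iff hσv hv]
    grind
  · intro k hk
    rw [Finset.mem_filter] at hk ⊢
    simp only [Finset.mem_univ, true_and, twistedForm, map_mul, map_add] at hk ⊢
    rw [hk]
    grind
  · intro c _
    field_simp
    grind
  · intro k _
    field_simp
    grind

theorem card_filter_fst_mem {α β : Type} [Fintype α] [Fintype β] [DecidableEq α]
    (U : Finset α) (P : α → β → Prop) [∀ a, DecidablePred (P a)] (n : ℕ)
    (h : ∀ a ∈ U, (Finset.univ.filter (P a)).card = n) :
    (Finset.univ.filter fun p : α × β => p.1 ∈ U ∧ P p.1 p.2).card = U.card * n := by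
  rw [Finset.card_eq_sum_card_fiberwise (f := Prod.fst) (t := U) (fun p hp => by simp_all),
    Finset.sum_const_nat]
  intro a ha
  rw [← h a ha]
  exact Finset.card_bij' (fun p _ => p.2) (fun b _ => (a, b)) (by grind) (by grind) (by grind)
    (by grind)

theorem card_twistedPairing_fst_mem (σ : F →+* F) (h2 : (2 : F) = 0)
    (hK : (Finset.univ.filter fun z => σ z = z).card = 4) (u : F) (h0 : u ≠ 0) (h1 : u ≠ 1) :
    (Finset.univ.filter fun p : F × F => p.1 ∈ ({0, 1, u, u + 1} : Finset F) ∧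
      twistedForm σ p.1 u + twistedForm σ p.2 (u + 1) = twistedForm σ 1 u).card = 16 := by
  have hu : u + 1 ≠ 0 := by grind
  rw [card_filter_fst_mem {0, 1, u, u + 1}
    (fun a c => twistedForm σ a u + twistedForm σ c (u + 1) = twistedForm σ 1 u) 4,
    card_zero_one_self_succ h2 u h0 h1]
  intro a ha
  obtain ⟨b, hb⟩ : ∃ b, twistedForm σ a u + twistedForm σ b (u + 1) = twistedForm σ 1 u := by
    simp only [Finset.mem_insert, Finset.mem_singleton] at ha
    simp only [twistedForm, map_add, map_one]
    rcases ha with rfl | rfl | rfl | rfl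
    · exact ⟨1, by simp; grind⟩
    · exact ⟨0, by simp⟩
    · exact ⟨1, by simp; grind⟩
    · exact ⟨0, by simp; grind⟩
  rw [← card_twistedForm_eq σ h2 hK (u + 1) b hu]
  congr 1
  ext c
  simp only [Finset.mem_filter, Finset.mem_univ, true_and, ← hb, add_right_inj]

theorem card_twistedPairing_snd_mem (σ : F →+* F) (h2 : (2 : F) = 0)
    (hK : (Finset.univ.filter fun z => σ z = z).card = 4) (u : F) (h0 : u ≠ 0) (h1 : u ≠ 1) :
    (Finset.univ.filter fun p : F × F => p.2 ∈ ({0, 1, u, u + 1} : Finset F) ∧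
      twistedForm σ p.1 u + twistedForm σ p.2 (u + 1) = twistedForm σ 1 u).card = 16 := by
  rw [← card_twistedPairing_fst_mem σ h2 hK (u + 1) (by grind) (by grind)]
  have hu : u + 1 + 1 = u := by grind
  refine Finset.card_equiv (Equiv.prodComm F F) fun p => ?_
  simp only [Finset.mem_filter, Finset.mem_univ, true_and, hu, Equiv.prodComm_apply, Prod.fst_swap,
    Prod.snd_swap, Finset.mem_insert, Finset.mem_singleton]
  refine and_congr (by tauto) ?_
  simp only [twistedForm, map_add, map_one]
  grind

theorem card_twistedPairing_add_mem (σ : F →+* F) (h2 : (2 : F) = 0)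
    (hK : (Finset.univ.filter fun z => σ z = z).card = 4) (u : F) (h0 : u ≠ 0) (h1 : u ≠ 1) :
    (Finset.univ.filter fun p : F × F => p.1 + p.2 ∈ ({0, 1, u, u + 1} : Finset F) ∧
      twistedForm σ p.1 u + twistedForm σ p.2 (u + 1) = twistedForm σ 1 u).card = 16 := by
  have hcard : (Finset.univ.filter fun p : F × F => p.1 ∈ ({0, 1, u, u + 1} : Finset F) ∧
      twistedForm σ p.2 u + twistedForm σ (p.1 + p.2) (u + 1) = twistedForm σ 1 u).card = 16 := by
    rw [card_filter_fst_mem {0, 1, u, u + 1}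
      (fun d a => twistedForm σ a u + twistedForm σ (d + a) (u + 1) = twistedForm σ 1 u) 4,
      card_zero_one_self_succ h2 u h0 h1]
    intro d hd
    obtain ⟨b, hb⟩ : ∃ b, twistedForm σ b 1 = twistedForm σ 1 u + twistedForm σ d (u + 1) := by
      simp only [Finset.mem_insert, Finset.mem_singleton] at hd
      simp only [twistedForm, map_add, map_one]
      rcases hd with rfl | rfl | rfl | rfl
      · exact ⟨u, by simp; grind⟩
      · exact ⟨0, by simp; grind⟩
      · exact ⟨0, by simp; grind⟩
      · exact ⟨u, by simp; grind⟩
    rw [← card_twistedForm_eq σ h2 hK 1 b one_ne_zero]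
    congr 1
    ext c
    simp only [Finset.mem_filter, Finset.mem_univ, true_and, hb]
    simp only [twistedForm, map_add, map_one]
    grind
  rw [← hcard]
  refine Finset.card_bij' (fun p _ => (p.1 + p.2, p.1)) (fun p _ => (p.2, p.1 + p.2)) ?_ ?_ ?_ ?_
  · intro p hp
    have h : p.1 + p.2 + p.1 = p.2 := by grind
    simpa [h] using hp
  · intro p hp
    have h : p.2 + (p.1 + p.2) = p.1 := by grind
    simpa [h] using hp
  · grind
  · grind

theorem card_twistedPairing_fst_snd_mem (σ : F →+* F) (h2 : (2 : F) = 0) (u : F) (hu : σ u ≠ u) :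
    (Finset.univ.filter fun p : F × F => p.1 ∈ ({0, 1, u, u + 1} : Finset F) ∧
      p.2 ∈ ({0, 1, u, u + 1} : Finset F) ∧
      twistedForm σ p.1 u + twistedForm σ p.2 (u + 1) = twistedForm σ 1 u).card = 8 := by
  have h0 : u ≠ 0 := by rintro rfl; simp at hu
  have h1 : u ≠ 1 := by rintro rfl; simp at hu
  have hu1 : u + 1 ≠ 0 := by grind
  rw [card_filter_fst_mem {0, 1, u, u + 1}
    (fun a c => c ∈ ({0, 1, u, u + 1} : Finset F) ∧
      twistedForm σ a u + twistedForm σ c (u + 1) = twistedForm σ 1 u) 2,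
    card_zero_one_self_succ h2 u h0 h1]
  intro a ha
  have key : ∀ c ∈ ({0, 1, u, u + 1} : Finset F),
      (twistedForm σ a u + twistedForm σ c (u + 1) = twistedForm σ 1 u ↔
        ((a = 0 ∨ a = u) ↔ (c = 1 ∨ c = u))) := by
    intro c hc
    simp only [Finset.mem_insert, Finset.mem_singleton] at ha hc
    rcases ha with rfl | rfl | rfl | rfl <;> rcases hc with rfl | rfl | rfl | rfl <;>
      simp [twistedForm] <;> grind
  by_cases h : a = 0 ∨ a = u
  · rw [← Finset.card_pair h1.symm]
    congr 1
    ext c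
    grind
  · rw [← Finset.card_pair hu1.symm]
    congr 1
    ext c
    grind

/-- For `u ≠ 0, 1` in characteristic two, the pairs `(a, c)` for which
`0, 1, a, a + u, c, c + u + 1` are distinct and have zero sum under `z ↦ σ z * z`. -/
def goodPairs (σ : F →+* F) (u : F) : Finset (F × F) :=
  Finset.univ.filter fun p => p.1 ∉ ({0, 1, u, u + 1} : Finset F) ∧
    p.2 ∉ ({0, 1, u, u + 1} : Finset F) ∧ p.1 + p.2 ∉ ({0, 1, u, u + 1} : Finset F) ∧
    twistedForm σ p.1 u + twistedForm σ p.2 (u + 1) = twistedForm σ 1 u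

theorem card_goodPairs_of_ne [CharP F 2] (σ : F →+* F)
    (hσ : ∀ z, σ (σ z) = z → σ z = z)
    (hK : (Finset.univ.filter fun z => σ z = z).card = 4) (u : F) (hu : σ u ≠ u) :
    (goodPairs σ u).card = Fintype.card F - 32 := by
  have h2 : (2 : F) = 0 := CharTwo.two_eq_zero
  have h0 : u ≠ 0 := by rintro rfl; simp at hu
  have h1 : u ≠ 1 := by rintro rfl; simp at hu
  have hS := card_fiber_of_surjective _ (twistedPairing_surjective σ hσ u hu) (twistedForm σ 1 u)
  have hA := card_twistedPairing_fst_mem σ h2 hK u h0 h1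
  have hC := card_twistedPairing_snd_mem σ h2 hK u h0 h1
  have hE := card_twistedPairing_add_mem σ h2 hK u h0 h1
  have hAC := card_twistedPairing_fst_snd_mem σ h2 u hu
  set S := Finset.univ.filter fun p => twistedPairing σ u (u + 1) p = twistedForm σ 1 u with hSd
  set A := Finset.univ.filter fun p : F × F => p.1 ∈ ({0, 1, u, u + 1} : Finset F) ∧
      twistedForm σ p.1 u + twistedForm σ p.2 (u + 1) = twistedForm σ 1 u with hAd
  set C := Finset.univ.filter fun p : F × F => p.2 ∈ ({0, 1, u, u + 1} : Finset F) ∧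
      twistedForm σ p.1 u + twistedForm σ p.2 (u + 1) = twistedForm σ 1 u with hCd
  set E := Finset.univ.filter fun p : F × F => p.1 + p.2 ∈ ({0, 1, u, u + 1} : Finset F) ∧
      twistedForm σ p.1 u + twistedForm σ p.2 (u + 1) = twistedForm σ 1 u with hEd
  have hadd : ∀ a ∈ ({0, 1, u, u + 1} : Finset F), ∀ c ∈ ({0, 1, u, u + 1} : Finset F),
      a + c ∈ ({0, 1, u, u + 1} : Finset F) := by
    intro a ha c hc
    simp only [Finset.mem_insert, Finset.mem_singleton] at ha hc ⊢
    grind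
  have hmS : ∀ p, p ∈ S ↔
      twistedForm σ p.1 u + twistedForm σ p.2 (u + 1) = twistedForm σ 1 u := fun p => by
    rw [hSd, Finset.mem_filter]
    simp [twistedPairing]
  have hAC' : (A ∩ C).card = 8 := by
    rw [← hAC]
    congr 1
    ext p
    simp only [hAd, hCd, Finset.mem_inter, Finset.mem_filter, Finset.mem_univ, true_and]
    tauto
  have hACE : (A ∪ C) ∩ E = A ∩ C := by
    ext p
    have e₂ : p.1 + (p.1 + p.2) = p.2 := by grind
    have e₃ : p.2 + (p.1 + p.2) = p.1 := by grind
    have h₁ := fun h h' => hadd p.1 h p.2 h'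
    have h₂ := fun h h' => hadd p.1 h (p.1 + p.2) h'
    have h₃ := fun h h' => hadd p.2 h (p.1 + p.2) h'
    rw [e₂] at h₂
    rw [e₃] at h₃
    simp only [hAd, hCd, hEd, Finset.mem_inter, Finset.mem_union, Finset.mem_filter,
      Finset.mem_univ, true_and]
    tauto
  have hgood : goodPairs σ u = S \ (A ∪ C ∪ E) := by
    ext p
    simp only [goodPairs, hAd, hCd, hEd, Finset.mem_sdiff, hmS, Finset.mem_union,
      Finset.mem_filter, Finset.mem_univ, true_and]
    tauto
  have hsub : A ∪ C ∪ E ⊆ S := by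
    intro p
    simp only [hAd, hCd, hEd, hmS, Finset.mem_union, Finset.mem_filter, Finset.mem_univ, true_and]
    tauto
  have c₁ := Finset.card_union_add_card_inter A C
  have c₂ := Finset.card_union_add_card_inter (A ∪ C) E
  rw [hACE] at c₂
  rw [hgood, Finset.card_sdiff_of_subset hsub, hS]
  omega

theorem card_goodPairs_of_eq (h2 : (2 : F) = 0) (σ : F →+* F)
    (hK : (Finset.univ.filter fun z => σ z = z).card = 4) (u : F) (hu : σ u = u)
    (h0 : u ≠ 0) (h1 : u ≠ 1) :
    (goodPairs σ u).card = (Fintype.card F - 4) * 4 := by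
  have hU : ({0, 1, u, u + 1} : Finset F) = Finset.univ.filter fun z => σ z = z := by
    apply Finset.eq_of_subset_of_card_le
    · intro z
      simp only [Finset.mem_insert, Finset.mem_singleton, Finset.mem_filter, Finset.mem_univ,
        true_and]
      rintro (rfl | rfl | rfl | rfl) <;> simp [hu]
    · rw [hK, card_zero_one_self_succ h2 u h0 h1]
  have hcompl : (Finset.univ.filter fun z => σ z = z)ᶜ.card = Fintype.card F - 4 := by
    rw [Finset.card_compl, hK]
  rw [← hcompl, ← card_filter_fst_mem (Finset.univ.filter fun z => σ z = z)ᶜ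
    (fun c a => twistedForm σ a u = twistedForm σ (c * (u + 1) / u) u) 4
    (fun c _ => card_twistedForm_eq σ h2 hK u _ h0)]
  refine Finset.card_equiv (Equiv.prodComm F F) fun ⟨a, c⟩ => ?_
  simp only [goodPairs, hU, Finset.mem_filter, Finset.mem_univ, true_and, Equiv.prodComm_apply,
    Finset.mem_compl, Prod.swap_prod_mk]
  have hu1 : u + 1 ≠ 0 := by grind
  simp only [twistedForm, map_add, map_one, hu, map_div₀, map_mul]
  have e₁ : σ c * (u + 1) / u * u = σ c * (u + 1) := by field_simp
  have e₂ : c * (u + 1) / u * u = c * (u + 1) := by field_simp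
  rw [e₁, e₂]
  constructor
  · rintro ⟨-, hc, -, h⟩
    exact ⟨hc, by grind⟩
  · rintro ⟨hc, h⟩
    have h' : (σ a + a) * u = (σ c + c) * (u + 1) := by linear_combination h
    have hc' : σ c + c ≠ 0 := by grind
    refine ⟨fun ha => ?_, hc, fun hac => ?_, by grind⟩
    · have : (σ c + c) * (u + 1) = 0 := by grind
      exact mul_ne_zero hc' hu1 this
    · exact hc' (by grind)

theorem card_good [CharP F 2] (σ : F →+* F)
    (hσ : ∀ z, σ (σ z) = z → σ z = z)
    (hK : (Finset.univ.filter fun z => σ z = z).card = 4) (hF : 32 ≤ Fintype.card F) :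
    (Finset.univ.filter fun t : F × F × F => t.1 ≠ 0 ∧ t.1 ≠ 1 ∧ t.2 ∈ goodPairs σ t.1).card =
      (Fintype.card F - 4) * (Fintype.card F - 24) := by
  have h2 : (2 : F) = 0 := CharTwo.two_eq_zero
  have c₁ := card_filter_fst_mem (Finset.univ.filter fun z => σ z = z)ᶜ
    (fun u p => p ∈ goodPairs σ u) (Fintype.card F - 32) (fun u hu => by
      rw [Finset.filter_univ_mem]
      exact card_goodPairs_of_ne σ hσ hK u (by simpa using hu))
  have c₂ := card_filter_fst_mem ((Finset.univ.filter fun z => σ z = z) \ {0, 1})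
    (fun u p => p ∈ goodPairs σ u) ((Fintype.card F - 4) * 4) (fun u hu => by
      simp only [Finset.mem_sdiff, Finset.mem_filter, Finset.mem_univ, true_and,
        Finset.mem_insert, Finset.mem_singleton, not_or] at hu
      rw [Finset.filter_univ_mem]
      exact card_goodPairs_of_eq h2 σ hK u hu.1 hu.2.1 hu.2.2)
  rw [Finset.card_compl, hK] at c₁
  rw [Finset.card_sdiff_of_subset (by intro z; simp; rintro (rfl | rfl) <;> simp), hK,
    Finset.card_pair zero_ne_one] at c₂
  have hunion : (Finset.univ.filter fun t : F × F × F =>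
      t.1 ≠ 0 ∧ t.1 ≠ 1 ∧ t.2 ∈ goodPairs σ t.1) =
      (Finset.univ.filter fun t : F × F × F =>
        t.1 ∈ (Finset.univ.filter fun z => σ z = z)ᶜ ∧ t.2 ∈ goodPairs σ t.1) ∪
      (Finset.univ.filter fun t : F × F × F =>
        t.1 ∈ (Finset.univ.filter fun z => σ z = z) \ {0, 1} ∧ t.2 ∈ goodPairs σ t.1) := by
    ext ⟨u, p⟩
    have h0 : σ u ≠ u → u ≠ 0 := by rintro h rfl; simp at h
    have h1 : σ u ≠ u → u ≠ 1 := by rintro h rfl; simp at h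
    simp only [Finset.mem_union, Finset.mem_filter, Finset.mem_univ, true_and, Finset.mem_compl,
      Finset.mem_sdiff, Finset.mem_insert, Finset.mem_singleton]
    tauto
  rw [hunion, Finset.card_union_of_disjoint, c₁, c₂]
  · obtain ⟨n, hn⟩ := Nat.exists_eq_add_of_le hF
    rw [hn]
    have e₁ : 32 + n - 4 = 28 + n := by omega
    have e₂ : 32 + n - 32 = n := by omega
    have e₃ : 32 + n - 24 = 8 + n := by omega
    rw [e₁, e₂, e₃]
    ring
  · rw [Finset.disjoint_left]
    simp only [Finset.mem_filter, Finset.mem_univ, true_and, Finset.mem_compl, Finset.mem_sdiff]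
    tauto

end TwistedForm

section Frobenius

variable {F : Type} [Field F] [Fintype F] [CharP F 2]

theorem iterateFrobenius_eq_self_iff (m e : ℕ) (hF : Fintype.card F = 2 ^ m)
    (hgcd : Nat.gcd m e = 2) (z : F) : iterateFrobenius F 2 e z = z ↔ z ^ 4 = z := by
  have hper : ∀ n, Function.IsPeriodicPt (frobenius F 2) n z ↔ z ^ 2 ^ n = z := fun n => by
    rw [Function.IsPeriodicPt, Function.IsFixedPt, iterate_frobenius]
  have h4 : z ^ 4 = z ↔ Function.IsPeriodicPt (frobenius F 2) 2 z := by rw [hper]; norm_num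
  rw [iterateFrobenius_def, ← hper, h4]
  constructor
  · intro h
    have hm : Function.IsPeriodicPt (frobenius F 2) m z := by
      rw [hper, ← hF, FiniteField.pow_card]
    have h' := hm.gcd h
    rwa [hgcd] at h'
  · intro h
    exact h.trans_dvd (hgcd ▸ Nat.gcd_dvd_right m e)

theorem card_pow_four_eq_self [DecidableEq F] (m : ℕ) (hF : Fintype.card F = 2 ^ m)
    (hm : 2 ∣ m) : (Finset.univ.filter fun z : F => z ^ 4 = z).card = 4 := by
  have h2 : (2 : F) = 0 := CharTwo.two_eq_zero
  have h3 : 3 ∣ Fintype.card Fˣ := by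
    obtain ⟨k, rfl⟩ := hm
    rw [Fintype.card_units, hF, pow_mul]
    have := Nat.sub_dvd_pow_sub_pow (2 ^ 2) 1 k
    rwa [one_pow] at this
  obtain ⟨w, hw⟩ := exists_prime_orderOf_dvd_card 3 h3
  have hw3 : (w : F) ^ 3 = 1 := by
    rw [← Units.val_pow_eq_pow_val, ← hw, pow_orderOf_eq_one, Units.val_one]
  have hw1 : (w : F) ≠ 1 := by
    intro h
    rw [Units.val_eq_one.mp h, orderOf_one] at hw
    omega
  have hq : (w : F) ^ 2 + w + 1 = 0 := by
    refine (mul_eq_zero.mp (?_ : ((w : F) - 1) * _ = 0)).resolve_left (sub_ne_zero.mpr hw1)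
    linear_combination hw3
  refine Eq.trans (congrArg Finset.card ?_) (card_zero_one_self_succ h2 (w : F) w.ne_zero hw1)
  ext z
  simp only [Finset.mem_filter, Finset.mem_univ, true_and, Finset.mem_insert,
    Finset.mem_singleton]
  constructor
  · intro h
    have hz : z * ((z - 1) * ((z - w) * (z - (w + 1)))) = 0 := by grind
    simpa [sub_eq_zero] using hz
  · rintro (rfl | rfl | rfl | rfl) <;> grind

end Frobenius

theorem card_embedding_map_eq {α : Type} [Fintype α] [DecidableEq α] (T : Finset α) (n : ℕ)
    (hT : T.card = n) :
    (Finset.univ.filter fun t : Fin n ↪ α => Finset.univ.map t = T).card = n.factorial := by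
  rw [← Fintype.card_subtype]
  have e : Fin n ≃ T := (Finset.equivFinOfCardEq hT).symm
  have h := Fintype.card_equiv e
  rw [Fintype.card_fin] at h
  rw [← h]
  refine Fintype.card_congr
    { toFun := fun t => Equiv.ofBijective
        (fun i => ⟨t.1 i, t.2.subset (Finset.mem_map_of_mem _ (Finset.mem_univ i))⟩) ?_
      invFun := fun g => ⟨g.toEmbedding.trans (Function.Embedding.subtype _), ?_⟩
      left_inv := fun t => by rfl
      right_inv := fun g => Equiv.ext fun _ => rfl }
  · refine ⟨fun i j hij => t.1.injective (by simpa using hij), fun ⟨b, hb⟩ => ?_⟩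
    rw [← t.2] at hb
    obtain ⟨i, -, hi⟩ := Finset.mem_map.mp hb
    exact ⟨i, Subtype.ext hi⟩
  · ext b
    simp only [Finset.mem_map, Finset.mem_univ, true_and, Function.Embedding.trans_apply,
      Equiv.coe_toEmbedding, Function.Embedding.subtype_apply]
    constructor
    · rintro ⟨i, rfl⟩
      exact (g i).2
    · intro hb
      exact ⟨g.symm ⟨b, hb⟩, by simp⟩

/-- Each block through `x` and `y` arises from the `24` orderings of its remaining points. -/
theorem card_blocks_mul {F : Type} [Field F] [Fintype F] [DecidableEq F] (f : F → F) (x y : F)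
    (hxy : x ≠ y) :
    (Finset.univ.filter fun B : Finset F => B.card = 6 ∧ x ∈ B ∧ y ∈ B ∧
      ∑ g ∈ B, g = 0 ∧ ∑ g ∈ B, f g = 0).card * 24 =
    (Finset.univ.filter fun t : Fin 4 ↪ F => (∀ i, t i ≠ x ∧ t i ≠ y) ∧
      x + (y + ∑ i, t i) = 0 ∧ f x + (f y + ∑ i, f (t i)) = 0).card := by
  rw [Finset.card_eq_sum_card_fiberwise (f := fun t => insert x (insert y (Finset.univ.map t)))
    (t := Finset.univ.filter fun B : Finset F => B.card = 6 ∧ x ∈ B ∧ y ∈ B ∧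
      ∑ g ∈ B, g = 0 ∧ ∑ g ∈ B, f g = 0)]
  · rw [Finset.sum_const_nat]
    intro B hB
    simp only [Finset.mem_filter, Finset.mem_univ, true_and] at hB
    obtain ⟨hcard, hx, hy, hs, hf⟩ := hB
    have hyx : y ∈ B.erase x := Finset.mem_erase.mpr ⟨hxy.symm, hy⟩
    have hT : ((B.erase x).erase y).card = 4 := by
      rw [Finset.card_erase_of_mem hyx, Finset.card_erase_of_mem hx, hcard]
    rw [← show Nat.factorial 4 = 24 from rfl, ← card_embedding_map_eq _ 4 hT]
    congr 1
    ext t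
    simp only [Finset.mem_filter, Finset.mem_univ, true_and]
    constructor
    · rintro ⟨⟨hne, -, -⟩, rfl⟩
      rw [Finset.erase_insert, Finset.erase_insert]
      · simpa using fun i => (hne i).2
      · simpa [hxy] using fun i => (hne i).1
    · intro h
      have hins : insert x (insert y (Finset.univ.map t)) = B := by
        rw [h, Finset.insert_erase hyx, Finset.insert_erase hx]
      refine ⟨⟨fun i => ?_, ?_, ?_⟩, hins⟩
      · have hi : t i ∈ (B.erase x).erase y :=
          h ▸ Finset.mem_map_of_mem _ (Finset.mem_univ i)
        grind
      · rw [← hs, ← Finset.add_sum_erase B _ hx, ← Finset.add_sum_erase (B.erase x) _ hyx, ← h,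
          Finset.sum_map]
      · rw [← hf, ← Finset.add_sum_erase B _ hx, ← Finset.add_sum_erase (B.erase x) _ hyx, ← h,
          Finset.sum_map]
  · intro t ht
    simp only [Finset.coe_filter, Finset.mem_univ, true_and, Set.mem_ofPred_eq] at ht ⊢
    obtain ⟨hne, hs, hf⟩ := ht
    have hy : y ∉ Finset.univ.map t := by simpa using fun i => (hne i).2
    have hx : x ∉ insert y (Finset.univ.map t) := by simpa [hxy] using fun i => (hne i).1
    rw [Finset.card_insert_of_notMem hx, Finset.card_insert_of_notMem hy, Finset.sum_insert hx,
      Finset.sum_insert hy, Finset.sum_insert hx, Finset.sum_insert hy, Finset.sum_map,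
      Finset.sum_map]
    simp [hs, hf]

theorem quadruple_separated {F : Type*} [Field F] (h2 : (2 : F) = 0) {p q r d : F}
    (hd : d = r + (p + q) + 1) (hq0 : q ≠ 0) (hq1 : q ≠ 1) (hd0 : d ≠ 0) (hd1 : d ≠ 1)
    (hpq : p ≠ q) (hpr : p ≠ r) (hpd : p ≠ d) (hqr : q ≠ r) (hqd : q ≠ d) (hrd : r ≠ d) :
    p + q ≠ 0 ∧ p + q ≠ 1 ∧ (¬p = p + q ∧ ¬p = p + q + 1) ∧ (¬r = p + q ∧ ¬r = p + q + 1) ∧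
      (¬p + r = 0 ∧ ¬p + r = 1 ∧ ¬p + r = p + q ∧ ¬p + r = p + q + 1) := by
  refine ⟨?_, ?_, ⟨?_, ?_⟩, ⟨?_, ?_⟩, ?_, ?_, ?_, ?_⟩ <;> grind

/-- Orderings of four points completing `x, y` to a block, normalized by the affine map that
sends `x, y` to `0, 1`. -/
theorem card_orderings {F : Type} [Field F] [Fintype F] [DecidableEq F] (h2 : (2 : F) = 0)
    (σ : F →+* F) (x y : F) (hxy : x ≠ y) :
    (Finset.univ.filter fun t : Fin 4 ↪ F => (∀ i, t i ≠ x ∧ t i ≠ y) ∧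
      x + (y + ∑ i, t i) = 0 ∧ σ x * x + (σ y * y + ∑ i, σ (t i) * t i) = 0).card =
    (Finset.univ.filter fun t : F × F × F =>
      t.1 ≠ 0 ∧ t.1 ≠ 1 ∧ t.2 ∈ goodPairs σ t.1).card := by
  obtain ⟨s, rfl⟩ : ∃ s, y = x + s := ⟨y - x, by ring⟩
  have hs : s ≠ 0 := by simpa using hxy
  have hσs : σ s ≠ 0 := (map_ne_zero σ).mpr hs
  symm
  refine Finset.card_bij
    (fun t ht => ⟨![x + s * t.2.1, x + s * (t.2.1 + t.1), x + s * t.2.2,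
      x + s * (t.2.2 + t.1 + 1)], ?_⟩) ?_ ?_ ?_
  · have hcancel : ∀ a b : F, x + s * a = x + s * b ↔ a = b := by simp [hs]
    obtain ⟨u, a, c⟩ := t
    simp only [goodPairs, Finset.mem_filter, Finset.mem_univ, true_and, Finset.mem_insert,
      Finset.mem_singleton, not_or] at ht
    simp only [Function.Injective, Fin.forall_fin_succ, Matrix.cons_val_zero, Matrix.cons_val_succ,
      IsEmpty.forall_iff, hcancel]
    have h01 : a ≠ a + u := by grind
    have h02 : a ≠ c := by grind
    have h03 : a ≠ c + u + 1 := by grind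
    have h12 : a + u ≠ c := by grind
    have h13 : a + u ≠ c + u + 1 := by grind
    have h23 : c ≠ c + u + 1 := by grind
    simp [h01, h02, h03, h12, h13, h23, h01.symm, h02.symm, h03.symm, h12.symm, h13.symm,
      h23.symm]
  · rintro ⟨u, a, c⟩ ht
    simp only [goodPairs, twistedForm, map_add, map_one, Finset.mem_filter, Finset.mem_univ,
      true_and, Finset.mem_insert, Finset.mem_singleton, not_or] at ht
    have hx : ∀ a : F, x + s * a = x ↔ a = 0 := by simp [hs]
    have hy : ∀ a : F, x + s * a = x + s ↔ a = 1 := by simp [hs]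
    simp only [Finset.mem_filter, Finset.mem_univ, true_and, Function.Embedding.coeFn_mk,
      Fin.sum_univ_four, Fin.forall_fin_succ, Matrix.cons_val, Matrix.cons_val_zero,
      Matrix.cons_val_succ, IsEmpty.forall_iff, hx, hy, ne_eq, map_add, map_mul, map_one]
    obtain ⟨-, -, ⟨ha0, ha1, hau, hau1⟩, ⟨hc0, hc1, hcu, hcu1⟩, -, h⟩ := ht
    clear hx hy
    have hau0 : a + u ≠ 0 := by grind
    have hau1 : a + u ≠ 1 := by grind
    have hcu0 : c + u + 1 ≠ 0 := by grind
    have hcu1 : c + u + 1 ≠ 1 := by grind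
    refine ⟨by simp [*], by grind, ?_⟩
    grind
  · rintro ⟨u, a, c⟩ ht ⟨u', a', c'⟩ ht' h
    have h' := congrArg (fun t : Fin 4 ↪ F => (t : Fin 4 → F)) h
    have h₀ := congrFun h' 0
    have h₁ := congrFun h' 1
    have h₂ := congrFun h' 2
    simp [hs] at h₀ h₁ h₂
    grind
  · intro t ht
    simp only [Finset.mem_filter, Finset.mem_univ, true_and, Fin.sum_univ_four] at ht
    obtain ⟨hne, hsum, hform⟩ := ht
    have hi : Function.Injective t := t.injective
    obtain ⟨b, hb⟩ : ∃ b : Fin 4 → F, ∀ i, t i = x + s * b i :=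
      ⟨fun i => (t i - x) / s, fun i => by field_simp; ring⟩
    have hb3 : b 3 = b 2 + (b 0 + b 1) + 1 := by
      apply mul_left_cancel₀ hs
      simp only [hb] at hsum
      grind
    have hbi : Function.Injective b := fun i j hij => hi (by rw [hb, hb, hij])
    have hb0 : ∀ i, b i ≠ 0 := fun i h => (hne i).1 (by simp [hb, h])
    have hb1 : ∀ i, b i ≠ 1 := fun i h => (hne i).2 (by simp [hb, h])
    have h01 := hbi.ne (show (0 : Fin 4) ≠ 1 by decide)
    have h02 := hbi.ne (show (0 : Fin 4) ≠ 2 by decide)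
    have h03 := hbi.ne (show (0 : Fin 4) ≠ 3 by decide)
    have h12 := hbi.ne (show (1 : Fin 4) ≠ 2 by decide)
    have h13 := hbi.ne (show (1 : Fin 4) ≠ 3 by decide)
    have h23 := hbi.ne (show (2 : Fin 4) ≠ 3 by decide)
    refine ⟨(b 0 + b 1, b 0, b 2), ?_, ?_⟩
    · simp only [goodPairs, twistedForm, map_add, map_one, Finset.mem_filter, Finset.mem_univ,
        true_and, Finset.mem_insert, Finset.mem_singleton, not_or]
      obtain ⟨hu0, hu1, ha, hc, hac⟩ := quadruple_separated h2 hb3 (hb0 1) (hb1 1) (hb0 3) (hb1 3)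
        h01 h02 h03 h12 h13 h23
      refine ⟨hu0, hu1, ⟨hb0 0, hb1 0, ha⟩, ⟨hb0 2, hb1 2, hc⟩, hac, ?_⟩
      apply mul_left_cancel₀ (mul_ne_zero hσs hs)
      simp only [hb, hb3, map_add, map_mul, map_one] at hform
      grind
    · ext i
      have e₁ : b 0 + (b 0 + b 1) = b 1 := by grind
      fin_cases i <;> simp [hb, hb3, e₁]

/-- The 6-element subsets `B` of `F = GF(2^m)` with `∑_{g∈B} g = 0` and
`∑_{g∈B} g^{2^e+1} = 0` form a `2-(2^m, 6, (2^m-4)(2^m-24)/24)` design: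
every 2-element subset `{x,y}` of `F` is contained in exactly
`(2^m-4)(2^m-24)/24` such subsets. -/
theorem design_weight6 (m : ℕ) (hm6 : 6 ≤ m) (hm4 : m % 4 = 2)
    (e : ℕ) (he2 : 2 ≤ e) (hem : 2 * e ≤ m) (hgcd : Nat.gcd m e = 2)
    (F : Type) [Field F] [Fintype F] (hF : Fintype.card F = 2 ^ m)
    (x y : F) (hxy : x ≠ y) :
    Nat.card {B : Finset F // B.card = 6 ∧ x ∈ B ∧ y ∈ B ∧
        (∑ g ∈ B, g = 0) ∧ (∑ g ∈ B, g ^ (2 ^ e + 1) = 0)} =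
      (2 ^ m - 4) * (2 ^ m - 24) / 24 := by
  classical
  have := charP_of_card_eq_prime_pow hF
  have h2 : (2 : F) = 0 := CharTwo.two_eq_zero
  have hgcd' : Nat.gcd m (e + e) = 2 := by
    obtain ⟨k, rfl⟩ : 2 ∣ e := hgcd ▸ Nat.gcd_dvd_right m e
    obtain ⟨n, rfl⟩ : 2 ∣ m := by omega
    rw [Nat.gcd_mul_left] at hgcd
    have hk : Nat.Coprime n k := by
      unfold Nat.Coprime
      omega
    have hn : Nat.Coprime n 2 := by
      rw [Nat.coprime_two_right, Nat.odd_iff]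
      omega
    rw [← two_mul, Nat.gcd_mul_left, hn.mul_right hk]
  have hσ : ∀ z : F, iterateFrobenius F 2 e (iterateFrobenius F 2 e z) = z →
      iterateFrobenius F 2 e z = z := fun z hz => by
    rw [← iterateFrobenius_add_apply, iterateFrobenius_eq_self_iff m _ hF hgcd'] at hz
    rwa [iterateFrobenius_eq_self_iff m e hF hgcd]
  have hK : (Finset.univ.filter fun z : F => iterateFrobenius F 2 e z = z).card = 4 := by
    simp only [iterateFrobenius_eq_self_iff m e hF hgcd]
    exact card_pow_four_eq_self m hF (by omega)
  have hN : 32 ≤ Fintype.card F := by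
    rw [hF]
    exact le_trans (by norm_num) (Nat.pow_le_pow_right two_pos hm6)
  have hcount := card_blocks_mul (fun g => iterateFrobenius F 2 e g * g) x y hxy
  rw [card_orderings h2 _ x y hxy, card_good _ hσ hK hN, hF] at hcount
  rw [Nat.subtype_card _ fun B => ?_, ← hcount, Nat.mul_div_cancel _ (by norm_num)]
  rw [Finset.mem_filter_univ]
  simp only [iterateFrobenius_def, pow_succ]
end

section
/- Let m ≥ 6 with m ≡ 2 (mod 4), and let e be an integer with 2 ≤ e ≤ m/2 and gcd(m,e) = 2. Then the number of 6-element subsets B of F = GF(2^m) with ∑_{g∈B} g = 0 and ∑_{g∈B} g^{2^e+1} = 0 equals 2^m(2^m−1)(2^m−4)(2^m−24)/720. -/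
section Polar

variable {F : Type*} [Field F]

/-- The polar form `(x, y) ↦ σ(x) y + x σ(y)` of the quadratic map `x ↦ x σ(x)`. -/
def frobPolar (σ : F →+* F) (x y : F) : F := σ x * y + x * σ y

/-- Kernel of the polar form when the fixed points of `σ` are exactly `0, 1, ω, ω + 1`. -/
theorem frobPolar_eq_zero_iff [CharP F 2] {σ : F →+* F} {ω : F}
    (hσω : σ ω = ω)
    (hfix : ∀ x, σ x = x → x = 0 ∨ x = 1 ∨ x = ω ∨ x = ω + 1) {x y : F} (hx : x ≠ 0) :
    frobPolar σ x y = 0 ↔ y = 0 ∨ y = x ∨ y = ω * x ∨ y = (ω + 1) * x := by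
  have h2 : (2 : F) = 0 := CharTwo.two_eq_zero
  have hσx : σ x ≠ 0 := by simpa using hx
  unfold frobPolar
  constructor
  · intro h
    have h1 : σ (y / x) = y / x := by
      rw [map_div₀, div_eq_div_iff hσx hx]
      grind
    rcases hfix _ h1 with h | h | h | h <;> rw [div_eq_iff hx] at h <;> simp [h]
  · rintro (rfl | rfl | rfl | rfl) <;>
      (try simp only [map_mul, map_add, map_one, map_zero, mul_zero, zero_add, hσω]) <;>
      grind

theorem frobPolar_add_right (σ : F →+* F) (x y z : F) :
    frobPolar σ x (y + z) = frobPolar σ x y + frobPolar σ x z := by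
  simp only [frobPolar, map_add]; ring

theorem frobPolar_comm (σ : F →+* F) (x y : F) :
    frobPolar σ x y = frobPolar σ y x := by
  simp only [frobPolar]; ring

theorem frobPolar_self [CharP F 2] (σ : F →+* F) (x : F) : frobPolar σ x x = 0 := by
  have h2 : (2 : F) = 0 := CharTwo.two_eq_zero
  simp only [frobPolar]; grind

/-- Solutions of `B(x, z) = B(x, y)` in `z`. -/
theorem frobPolar_eq_iff [CharP F 2] {σ : F →+* F} {ω : F}
    (hσω : σ ω = ω)
    (hfix : ∀ x, σ x = x → x = 0 ∨ x = 1 ∨ x = ω ∨ x = ω + 1) {x y z : F} (hx : x ≠ 0) :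
    frobPolar σ x z = frobPolar σ x y ↔
      z = y ∨ z = y + x ∨ z = y + ω * x ∨ z = y + (ω + 1) * x := by
  have h2 : (2 : F) = 0 := CharTwo.two_eq_zero
  have h := frobPolar_eq_zero_iff hσω hfix (y := z + y) hx
  rw [frobPolar_add_right] at h
  have e1 : frobPolar σ x z = frobPolar σ x y ↔ frobPolar σ x z + frobPolar σ x y = 0 := by
    constructor <;> intro h <;> grind
  rw [e1, h]
  constructor <;> rintro (h | h | h | h) <;> grind

theorem card_quadruple [DecidableEq F] {ω : F} (hω : ω ^ 2 + ω + 1 = 0) (h2 : (2 : F) = 0)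
    {x : F} (hx : x ≠ 0) (y : F) :
    ({y, y + x, y + ω * x, y + (ω + 1) * x} : Finset F).card = 4 := by
  have hω0 : ω ≠ 0 := by rintro rfl; simp at hω
  have hω1 : ω + 1 ≠ 0 := by intro h; grind
  have hω2 : ω ≠ 1 := by
    rintro rfl
    exact one_ne_zero (α := F) (by linear_combination hω - h2)
  rw [Finset.card_insert_of_notMem, Finset.card_insert_of_notMem, Finset.card_insert_of_notMem,
    Finset.card_singleton]
  · simp; grind
  · simp; grind
  · simp [hx, hω0, hω1]

variable [Fintype F] [DecidableEq F]

theorem card_filter_frobPolar_snd [CharP F 2] {σ : F →+* F} {ω : F} (hω : ω ^ 2 + ω + 1 = 0)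
    (hσω : σ ω = ω)
    (hfix : ∀ x, σ x = x → x = 0 ∨ x = 1 ∨ x = ω ∨ x = ω + 1) {x y : F} (hx : x ≠ 0) :
    (Finset.univ.filter fun z => frobPolar σ x z = frobPolar σ x y).card = 4 := by
  rw [← card_quadruple hω CharTwo.two_eq_zero hx y]
  congr 1
  ext z
  simp [frobPolar_eq_iff hσω hfix hx]

/-- The pairs on which the polar form takes the value `t`. -/
def polarFiber (σ : F →+* F) (t : F) : Finset (F × F) :=
  Finset.univ.filter fun p => frobPolar σ p.1 p.2 = t

theorem card_polarFiber_zero [CharP F 2] {σ : F →+* F} {ω : F} (hω : ω ^ 2 + ω + 1 = 0)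
    (hσω : σ ω = ω)
    (hfix : ∀ x, σ x = x → x = 0 ∨ x = 1 ∨ x = ω ∨ x = ω + 1) :
    (polarFiber σ (0 : F)).card + 4 = 5 * Fintype.card F := by
  have h : (polarFiber σ (0 : F)).card =
      ∑ x : F, (Finset.univ.filter fun y => frobPolar σ x y = 0).card := by
    simp only [polarFiber, Finset.card_filter, Fintype.sum_prod_type]
  have h0 : (Finset.univ.filter fun y : F => frobPolar σ 0 y = 0).card = Fintype.card F := by
    simp [frobPolar]
  rw [h, ← Finset.add_sum_erase _ _ (Finset.mem_univ (0 : F)), h0]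
  have h1 : ∀ x ∈ Finset.univ.erase (0 : F),
      (Finset.univ.filter fun y => frobPolar σ x y = 0).card = 4 := by
    intro x hx
    have := card_filter_frobPolar_snd hω hσω hfix (y := 0) (Finset.ne_of_mem_erase hx)
    rwa [show frobPolar σ x 0 = 0 by simp [frobPolar]] at this
  rw [Finset.sum_congr rfl h1, Finset.sum_const, Finset.card_erase_of_mem (Finset.mem_univ _),
    Finset.card_univ, smul_eq_mul]
  have : 0 < Fintype.card F := Fintype.card_pos
  omega

theorem card_polarFiber_le {σ : F →+* F} (hsurj : ∀ t : F, ∃ c, σ c * c = t) {s t : F}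
    (hs : s ≠ 0) (ht : t ≠ 0) : (polarFiber σ s).card ≤ (polarFiber σ t).card := by
  obtain ⟨c, hc⟩ := hsurj (t / s)
  have hc0 : c ≠ 0 := by
    rintro rfl
    simp at hc
    grind
  refine Finset.card_le_card_of_injOn (fun p => (c * p.1, c * p.2)) ?_ ?_
  · intro p hp
    rw [Finset.mem_coe, polarFiber, Finset.mem_filter] at hp ⊢
    refine ⟨Finset.mem_univ _, ?_⟩
    replace hp := hp.2
    simp only [frobPolar, map_mul] at hp ⊢
    have : t = t / s * s := by field_simp
    rw [this, ← hc, ← hp]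
    ring
  · rintro ⟨a, b⟩ - ⟨a', b'⟩ - h
    simpa [hc0] using h

theorem card_polarFiber_ne_zero [CharP F 2] {σ : F →+* F} {ω : F} (hω : ω ^ 2 + ω + 1 = 0)
    (hσω : σ ω = ω)
    (hfix : ∀ x, σ x = x → x = 0 ∨ x = 1 ∨ x = ω ∨ x = ω + 1)
    (hsurj : ∀ t : F, ∃ c, σ c * c = t) {t : F} (ht : t ≠ 0) :
    (polarFiber σ t).card + 4 = Fintype.card F := by
  have h := Finset.card_eq_sum_card_fiberwise (s := (Finset.univ : Finset (F × F)))
    (t := (Finset.univ : Finset F)) (f := fun p => frobPolar σ p.1 p.2) (fun _ _ => by simp)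
  change _ = ∑ b : F, (polarFiber σ b).card at h
  have h1 : ∀ x ∈ Finset.univ.erase (0 : F),
      (polarFiber σ x).card = (polarFiber σ t).card := fun x hx =>
    le_antisymm (card_polarFiber_le hsurj (Finset.ne_of_mem_erase hx) ht)
      (card_polarFiber_le hsurj ht (Finset.ne_of_mem_erase hx))
  have h0 := card_polarFiber_zero hω hσω hfix
  rw [← Finset.add_sum_erase _ _ (Finset.mem_univ (0 : F)), Finset.sum_congr rfl h1,
    Finset.sum_const, Finset.card_erase_of_mem (Finset.mem_univ _), Finset.card_univ,
    Finset.card_univ, smul_eq_mul, Fintype.card_prod] at h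
  have hq : 1 < Fintype.card F := Fintype.one_lt_card
  obtain ⟨q, hq'⟩ : ∃ q, Fintype.card F = q + 1 := ⟨Fintype.card F - 1, by omega⟩
  rw [hq'] at h h0 hq ⊢
  simp only [Nat.add_sub_cancel] at h
  have hq0 : 0 < q := by omega
  have : q * ((polarFiber σ t).card + 4) = q * (q + 1) := by nlinarith
  exact Nat.eq_of_mul_eq_mul_left hq0 this

/-- The three nonzero elements of the `𝔽₂`-span of the pair `p`. -/
def tripleOf (p : F × F) : Finset F := {p.1, p.2, p.1 + p.2}

/-- The pairs with the same value of the polar form as `p` that are nondegenerate over `𝔽₂` and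
whose triple is disjoint from the triple of `p`. -/
def partners (σ : F →+* F) (p : F × F) : Finset (F × F) :=
  (polarFiber σ (frobPolar σ p.1 p.2)).filter fun r =>
    (r.1 ≠ 0 ∧ r.2 ≠ 0 ∧ r.1 ≠ r.2) ∧
      r.1 ∉ tripleOf p ∧ r.2 ∉ tripleOf p ∧ r.1 + r.2 ∉ tripleOf p

theorem card_partners_of_eq_zero [CharP F 2] {σ : F →+* F} {ω : F} (hω : ω ^ 2 + ω + 1 = 0)
    (hσω : σ ω = ω)
    (hfix : ∀ x, σ x = x → x = 0 ∨ x = 1 ∨ x = ω ∨ x = ω + 1)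
    {p : F × F} (h1 : p.1 ≠ 0) (h2 : p.2 ≠ 0) (h3 : p.1 ≠ p.2)
    (hp : frobPolar σ p.1 p.2 = 0) :
    (partners σ p).card + 8 = 2 * Fintype.card F := by
  have hc : (2 : F) = 0 := CharTwo.two_eq_zero
  have hω0 : ω ≠ 0 := by rintro rfl; simp at hω
  have hω1 : ω + 1 ≠ 0 := by intro h; grind
  have hω2 : ω ≠ 1 := by
    rintro rfl
    exact one_ne_zero (α := F) (by linear_combination hω - hc)
  obtain ⟨u, v⟩ := p
  simp only at h1 h2 h3 hp
  have hT : ∀ z, z ∈ tripleOf (u, v) ↔ z = u ∨ z = ω * u ∨ z = (ω + 1) * u := by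
    intro z
    have := (frobPolar_eq_zero_iff hσω hfix h1).1 hp
    simp only [tripleOf, Finset.mem_insert, Finset.mem_singleton]
    grind
  have key : partners σ (u, v) =
      (({0, 0 + u, 0 + ω * u, 0 + (ω + 1) * u} : Finset F)ᶜ ×ˢ ({ω, ω + 1} : Finset F)).image
        fun s => (s.1, s.2 * s.1) := by
    ext ⟨x, y⟩
    simp only [partners, polarFiber, Finset.mem_filter, Finset.mem_univ, true_and, hp, hT,
      Finset.mem_image, Finset.mem_product, Finset.mem_compl, Finset.mem_insert,
      Finset.mem_singleton, Prod.exists, Prod.mk.injEq, zero_add]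
    constructor
    · rintro ⟨hxy, ⟨hx, hy, hne⟩, hd⟩
      have := (frobPolar_eq_zero_iff hσω hfix hx).1 hxy
      refine ⟨x, y / x, ⟨by grind, ?_⟩, rfl, by field_simp⟩
      rw [div_eq_iff hx, div_eq_iff hx]
      grind
    · rintro ⟨a, c, ⟨ha, hc'⟩, rfl, rfl⟩
      have ha0 : a ≠ 0 := by grind
      have e1 : ∀ k, ω * a = k → a = (ω + 1) * k := by rintro k rfl; grind
      have e2 : ∀ k, (ω + 1) * a = k → a = ω * k := by rintro k rfl; grind
      rcases hc' with rfl | rfl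
      · refine ⟨(frobPolar_eq_zero_iff hσω hfix ha0).2 (by simp), ⟨ha0, by positivity, ?_⟩, ?_⟩
        · grind
        · grind
      · refine ⟨(frobPolar_eq_zero_iff hσω hfix ha0).2 (by simp),
          ⟨ha0, mul_ne_zero hω1 ha0, ?_⟩, ?_⟩
        · grind
        · grind
  rw [key, Finset.card_image_of_injOn, Finset.card_product, Finset.card_compl,
    card_quadruple hω hc h1, Finset.card_pair (by simp)]
  · have : 4 ≤ Fintype.card F := by
      rw [← card_quadruple hω hc h1 0]; exact Finset.card_le_univ _
    omega
  · rintro ⟨a, b⟩ ha ⟨a', b'⟩ - h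
    simp at ha h
    grind

theorem card_polarFiber_filter_fst [CharP F 2] {σ : F →+* F} {ω : F} (hω : ω ^ 2 + ω + 1 = 0)
    (hσω : σ ω = ω)
    (hfix : ∀ x, σ x = x → x = 0 ∨ x = 1 ∨ x = ω ∨ x = ω + 1) {t : F} (T : Finset F)
    (h0 : 0 ∉ T) (hT : ∀ x ∈ T, ∃ y, frobPolar σ x y = t) :
    ((polarFiber σ t).filter fun r => r.1 ∈ T).card = T.card * 4 := by
  have h : ((polarFiber σ t).filter fun r => r.1 ∈ T) =
      (T ×ˢ Finset.univ).filter fun r => frobPolar σ r.1 r.2 = t := by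
    ext r
    simp [polarFiber, and_comm]
  rw [h, Finset.card_filter, Finset.sum_product, ← smul_eq_mul, ← Finset.sum_const]
  refine Finset.sum_congr rfl fun x hx => ?_
  obtain ⟨y, rfl⟩ := hT x hx
  rw [← Finset.card_filter]
  exact card_filter_frobPolar_snd hω hσω hfix (by rintro rfl; exact h0 hx)

theorem card_polarFiber_filter_snd (σ : F →+* F) (t : F) (T : Finset F) :
    ((polarFiber σ t).filter fun r => r.2 ∈ T).card =
      ((polarFiber σ t).filter fun r => r.1 ∈ T).card := by
  refine Finset.card_nbij' (fun r => (r.2, r.1)) (fun r => (r.2, r.1)) ?_ ?_ ?_ ?_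
  · intro r
    simp [polarFiber, frobPolar_comm σ r.1 r.2]
  · intro r
    simp [polarFiber, frobPolar_comm σ r.1 r.2]
  · intro r _; rfl
  · intro r _; rfl

theorem card_polarFiber_filter_add [CharP F 2] (σ : F →+* F) (t : F) (T : Finset F) :
    ((polarFiber σ t).filter fun r => r.1 + r.2 ∈ T).card =
      ((polarFiber σ t).filter fun r => r.2 ∈ T).card := by
  have h2 : ∀ x y : F, x + (x + y) = y := fun x y => by
    rw [← add_assoc, CharTwo.add_self_eq_zero, zero_add]
  refine Finset.card_nbij' (fun r => (r.1, r.1 + r.2)) (fun r => (r.1, r.1 + r.2)) ?_ ?_ ?_ ?_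
  · intro r
    simp [polarFiber, frobPolar_add_right, frobPolar_self]
  · intro r
    simp [polarFiber, frobPolar_add_right, frobPolar_self, h2]
  · intro r _; simp [h2]
  · intro r _; simp [h2]

theorem card_partners_of_ne_zero [CharP F 2] {σ : F →+* F} {ω : F} (hω : ω ^ 2 + ω + 1 = 0)
    (hσω : σ ω = ω)
    (hfix : ∀ x, σ x = x → x = 0 ∨ x = 1 ∨ x = ω ∨ x = ω + 1)
    (hsurj : ∀ t : F, ∃ c, σ c * c = t)
    {p : F × F} (hp : frobPolar σ p.1 p.2 ≠ 0) :
    (partners σ p).card + 28 = Fintype.card F := by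
  have hc : (2 : F) = 0 := CharTwo.two_eq_zero
  obtain ⟨u, v⟩ := p
  simp only at hp
  have hS := card_polarFiber_ne_zero hω hσω hfix hsurj hp
  have hnd : ∀ x y, frobPolar σ x y ≠ 0 → x ≠ 0 ∧ y ≠ 0 ∧ x ≠ y := by
    intro x y h
    refine ⟨?_, ?_, ?_⟩ <;> rintro rfl <;> apply h
    · simp [frobPolar]
    · simp [frobPolar]
    · exact frobPolar_self σ x
  obtain ⟨hu, hv, huv⟩ := hnd u v hp
  set t := frobPolar σ u v with ht
  set T := tripleOf (u, v) with hTdef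
  have hmem : ∀ z, z ∈ T ↔ z = u ∨ z = v ∨ z = u + v := by simp [T, tripleOf]
  have hTcard : T.card = 3 := by
    rw [hTdef, tripleOf, Finset.card_insert_of_notMem, Finset.card_pair]
    · simpa using hu
    · simpa using ⟨huv, hv⟩
  have h0 : (0 : F) ∉ T := by rw [hmem]; grind
  have hfib : ∀ x ∈ T, ∃ y ∈ T, frobPolar σ x y = t := by
    have e : frobPolar σ (u + v) u = t := by
      rw [frobPolar_comm, frobPolar_add_right, frobPolar_self, zero_add]
    intro x hx
    rcases (hmem x).1 hx with rfl | rfl | rfl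
    · exact ⟨v, by simp [hmem], rfl⟩
    · exact ⟨u, by simp [hmem], frobPolar_comm σ _ _⟩
    · exact ⟨u, by simp [hmem], e⟩
  have hoff : ∀ x ∈ T, ∀ y ∈ T, x ≠ y → frobPolar σ x y = t ∧ x + y ∈ T := by
    have e1 : frobPolar σ v u = t := frobPolar_comm σ _ _
    intro x hx y hy hxy
    rcases (hmem x).1 hx with rfl | rfl | rfl <;> rcases (hmem y).1 hy with rfl | rfl | rfl <;>
      simp only [frobPolar_add_right, frobPolar_self, frobPolar_comm σ (_ + _), e1, hmem] <;> grind
  set E₁ := (polarFiber σ t).filter fun r => r.1 ∈ T with hE₁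
  set E₂ := (polarFiber σ t).filter fun r => r.2 ∈ T with hE₂
  set E₃ := (polarFiber σ t).filter fun r => r.1 + r.2 ∈ T with hE₃
  have c₁ : E₁.card = 12 := by
    rw [hE₁, card_polarFiber_filter_fst hω hσω hfix T h0 (fun x hx => ?_), hTcard]
    obtain ⟨y, -, hy⟩ := hfib x hx
    exact ⟨y, hy⟩
  have c₂ : E₂.card = 12 := (card_polarFiber_filter_snd σ t T).trans c₁
  have c₃ : E₃.card = 12 := (card_polarFiber_filter_add σ t T).trans c₂
  have hcancel : ∀ x y : F, x + (x + y) = y := fun x y => by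
    rw [← add_assoc, CharTwo.add_self_eq_zero, zero_add]
  have hpf : ∀ x y, (x, y) ∈ polarFiber σ t ↔ frobPolar σ x y = t := by simp [polarFiber]
  have i₁₂ : E₁ ∩ E₂ = T.offDiag := by
    ext ⟨x, y⟩
    simp only [hE₁, hE₂, Finset.mem_inter, Finset.mem_filter, Finset.mem_offDiag, hpf]
    constructor
    · rintro ⟨⟨h, hx⟩, -, hy⟩
      exact ⟨hx, hy, (hnd x y (h ▸ hp)).2.2⟩
    · rintro ⟨hx, hy, hxy⟩
      exact ⟨⟨(hoff x hx y hy hxy).1, hx⟩, (hoff x hx y hy hxy).1, hy⟩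
  have i₃ : (E₁ ∪ E₂) ∩ E₃ = T.offDiag := by
    ext ⟨x, y⟩
    simp only [hE₁, hE₂, hE₃, Finset.mem_inter, Finset.mem_union, Finset.mem_filter,
      Finset.mem_offDiag, hpf]
    constructor
    · rintro ⟨⟨h, hx⟩ | ⟨h, hy⟩, -, hxy⟩
      · obtain ⟨-, n2, n3⟩ := hnd x y (h ▸ hp)
        have := (hoff x hx _ hxy (by simpa using n2)).2
        rw [hcancel] at this
        exact ⟨hx, this, n3⟩
      · obtain ⟨n1, -, n3⟩ := hnd x y (h ▸ hp)
        have := (hoff y hy _ hxy (by simpa using n1)).2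
        rw [add_comm x, hcancel] at this
        exact ⟨this, hy, n3⟩
    · rintro ⟨hx, hy, hxy⟩
      obtain ⟨h, h'⟩ := hoff x hx y hy hxy
      exact ⟨Or.inl ⟨h, hx⟩, h, h'⟩
  have hoffcard : T.offDiag.card = 6 := by rw [Finset.offDiag_card, hTcard]
  have hpart : partners σ (u, v) = polarFiber σ t \ (E₁ ∪ E₂ ∪ E₃) := by
    ext ⟨x, y⟩
    simp only [partners, hE₁, hE₂, hE₃, Finset.mem_sdiff, Finset.mem_union, Finset.mem_filter,
      ← ht, ← hTdef, hpf]
    have := hnd x y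
    grind
  have hsub : E₁ ∪ E₂ ∪ E₃ ⊆ polarFiber σ t :=
    Finset.union_subset (Finset.union_subset (Finset.filter_subset _ _) (Finset.filter_subset _ _))
      (Finset.filter_subset _ _)
  have hu₁ := Finset.card_union_add_card_inter E₁ E₂
  have hu₂ := Finset.card_union_add_card_inter (E₁ ∪ E₂) E₃
  have hd := Finset.card_sdiff_add_card_eq_card hsub
  rw [← hpart] at hd
  rw [i₁₂] at hu₁
  rw [i₃] at hu₂
  omega

/-- The nondegenerate pairs. -/
def nondegPairs (F : Type*) [Field F] [Fintype F] [DecidableEq F] : Finset (F × F) :=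
  Finset.univ.filter fun p => p.1 ≠ 0 ∧ p.2 ≠ 0 ∧ p.1 ≠ p.2

theorem card_nondegPairs_zero [CharP F 2] {σ : F →+* F} {ω : F} (hω : ω ^ 2 + ω + 1 = 0)
    (hσω : σ ω = ω)
    (hfix : ∀ x, σ x = x → x = 0 ∨ x = 1 ∨ x = ω ∨ x = ω + 1) :
    ((nondegPairs F).filter fun p => frobPolar σ p.1 p.2 = 0).card =
      2 * (Fintype.card F - 1) := by
  have hc : (2 : F) = 0 := CharTwo.two_eq_zero
  have hω0 : ω ≠ 0 := by rintro rfl; simp at hω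
  have hω1 : ω + 1 ≠ 0 := by intro h; grind
  have hω2 : ω ≠ 1 := by
    rintro rfl
    exact one_ne_zero (α := F) (by linear_combination hω - hc)
  have key : ((nondegPairs F).filter fun p => frobPolar σ p.1 p.2 = 0) =
      ((Finset.univ.erase (0 : F)) ×ˢ ({ω, ω + 1} : Finset F)).image
        fun s => (s.1, s.2 * s.1) := by
    ext ⟨x, y⟩
    simp only [nondegPairs, Finset.mem_filter, Finset.mem_univ, true_and,
      Finset.mem_image, Finset.mem_product, Finset.mem_erase, Finset.mem_insert,
      Finset.mem_singleton, Prod.exists, Prod.mk.injEq, and_true]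
    constructor
    · rintro ⟨⟨hx, hy, hne⟩, hxy⟩
      have := (frobPolar_eq_zero_iff hσω hfix hx).1 hxy
      refine ⟨x, y / x, ⟨hx, ?_⟩, rfl, by field_simp⟩
      rw [div_eq_iff hx, div_eq_iff hx]
      grind
    · rintro ⟨a, c, ⟨ha, rfl | rfl⟩, rfl, rfl⟩
      · exact ⟨⟨ha, mul_ne_zero hω0 ha, by grind⟩,
          (frobPolar_eq_zero_iff hσω hfix ha).2 (by simp)⟩
      · exact ⟨⟨ha, mul_ne_zero hω1 ha, by grind⟩,
          (frobPolar_eq_zero_iff hσω hfix ha).2 (by simp)⟩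
  rw [key, Finset.card_image_of_injOn, Finset.card_product,
    Finset.card_erase_of_mem (Finset.mem_univ _), Finset.card_pair (by simp), Finset.card_univ,
    mul_comm]
  rintro ⟨a, b⟩ ha ⟨a', b'⟩ - h
  simp at ha h
  grind

theorem card_nondegPairs_ne_zero [CharP F 2] {σ : F →+* F} {ω : F} (hω : ω ^ 2 + ω + 1 = 0)
    (hσω : σ ω = ω)
    (hfix : ∀ x, σ x = x → x = 0 ∨ x = 1 ∨ x = ω ∨ x = ω + 1) :
    ((nondegPairs F).filter fun p => ¬ frobPolar σ p.1 p.2 = 0).card + 5 * Fintype.card F =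
      Fintype.card F ^ 2 + 4 := by
  have h : ((nondegPairs F).filter fun p => ¬ frobPolar σ p.1 p.2 = 0) =
      Finset.univ.filter fun p : F × F => ¬ frobPolar σ p.1 p.2 = 0 := by
    ext ⟨x, y⟩
    simp only [nondegPairs, Finset.mem_filter, Finset.mem_univ, true_and, and_iff_right_iff_imp]
    intro h
    refine ⟨?_, ?_, ?_⟩ <;> rintro rfl <;> apply h
    · simp [frobPolar]
    · simp [frobPolar]
    · exact frobPolar_self σ x
  have h1 := card_polarFiber_zero hω hσω hfix
  have h2 := Finset.card_filter_add_card_filter_not (s := (Finset.univ : Finset (F × F)))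
    (fun p : F × F => frobPolar σ p.1 p.2 = 0)
  rw [h]
  rw [Finset.card_univ, Fintype.card_prod] at h2
  rw [polarFiber] at h1
  rw [sq]
  omega

/-- Total number of compatible disjoint pairs of triples. -/
theorem sum_card_partners [CharP F 2] {σ : F →+* F} {ω : F} (hω : ω ^ 2 + ω + 1 = 0)
    (hσω : σ ω = ω)
    (hfix : ∀ x, σ x = x → x = 0 ∨ x = 1 ∨ x = ω ∨ x = ω + 1)
    (hsurj : ∀ t : F, ∃ c, σ c * c = t) (hq : 28 ≤ Fintype.card F) :
    ∑ p ∈ nondegPairs F, (partners σ p).card =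
      (Fintype.card F - 1) * (Fintype.card F - 4) * (Fintype.card F - 24) := by
  rw [← Finset.sum_filter_add_sum_filter_not _ fun p => frobPolar σ p.1 p.2 = 0]
  have h1 := Finset.sum_const_nat
    (s := (nondegPairs F).filter fun p => frobPolar σ p.1 p.2 = 0)
    (f := fun p => (partners σ p).card) (m := 2 * Fintype.card F - 8) (by
      intro p hp
      simp only [nondegPairs, Finset.mem_filter, Finset.mem_univ, true_and] at hp
      have := card_partners_of_eq_zero hω hσω hfix hp.1.1 hp.1.2.1 hp.1.2.2 hp.2
      omega)
  have h2 := Finset.sum_const_nat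
    (s := (nondegPairs F).filter fun p => ¬ frobPolar σ p.1 p.2 = 0)
    (f := fun p => (partners σ p).card) (m := Fintype.card F - 28) (by
      intro p hp
      have := card_partners_of_ne_zero hω hσω hfix hsurj (Finset.mem_filter.1 hp).2
      omega)
  have h3 := card_nondegPairs_ne_zero hω hσω hfix
  rw [h1, h2, card_nondegPairs_zero hω hσω hfix]
  generalize Finset.card _ = N at h3
  generalize Fintype.card F = q at *
  obtain ⟨k, rfl⟩ := Nat.exists_eq_add_of_le hq
  have hN : N = (27 + k) * (24 + k) := by nlinarith
  rw [hN, show 28 + k - 1 = 27 + k by omega, show 28 + k - 4 = 24 + k by omega,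
    show 28 + k - 24 = 4 + k by omega, show 28 + k - 28 = k by omega,
    show 2 * (28 + k) - 8 = 2 * (24 + k) by omega]
  ring

end Polar

section Tuples

/-- Each `n`-subset is the image of exactly `n!` injective `n`-tuples. -/
theorem card_injective_tuples {α : Type*} [Fintype α] [DecidableEq α] (n : ℕ)
    (P : Finset α → Prop) [DecidablePred P] :
    (Finset.univ.filter fun f : Fin n → α =>
        Function.Injective f ∧ P (Finset.univ.image f)).card =
      (Finset.univ.filter fun B : Finset α => B.card = n ∧ P B).card * n.factorial := by
  rw [Finset.card_eq_sum_card_fiberwise (t := Finset.univ.filter fun B : Finset α =>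
    B.card = n ∧ P B) (f := fun f => Finset.univ.image f)]
  · refine Finset.sum_const_nat fun B hB => ?_
    obtain ⟨hBn, hBP⟩ := (Finset.mem_filter.1 hB).2
    have e : {f : Fin n → α // Function.Injective f ∧ Finset.univ.image f = B} ≃ (Fin n ↪ B) :=
      { toFun := fun f => ⟨fun i => ⟨f.1 i, by
            have h := Finset.mem_image_of_mem f.1 (Finset.mem_univ i)
            rwa [f.2.2] at h⟩,
          fun i j h => f.2.1 (congrArg Subtype.val h)⟩
        invFun := fun g => ⟨Subtype.val ∘ g, Subtype.val_injective.comp g.injective, by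
          refine Finset.eq_of_subset_of_card_le ?_ ?_
          · intro x hx
            obtain ⟨i, -, rfl⟩ := Finset.mem_image.1 hx
            exact (g i).2
          · rw [Finset.card_image_of_injective _ (Subtype.val_injective.comp g.injective), hBn]
            simp⟩
        left_inv := fun f => rfl
        right_inv := fun g => rfl }
    have h := Fintype.card_congr e
    rw [Fintype.card_embedding_eq, Fintype.card_coe, hBn, Fintype.card_fin,
      Nat.descFactorial_self, Fintype.card_subtype] at h
    rw [← h, Finset.filter_filter]
    congr 1
    ext f
    simp only [Finset.mem_filter, Finset.mem_univ, true_and]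
    constructor
    · rintro ⟨⟨h1, -⟩, h2⟩; exact ⟨h1, h2⟩
    · rintro ⟨h1, rfl⟩; exact ⟨⟨h1, hBP⟩, rfl⟩
  · intro f hf
    rw [Finset.mem_coe, Finset.mem_filter] at hf ⊢
    exact ⟨Finset.mem_univ _, by simp [Finset.card_image_of_injective _ hf.2.1], hf.2.2⟩

variable {F : Type*} [Field F] [Fintype F] [DecidableEq F]

/-- In characteristic two, sums of pairs from two disjoint triples with a common sum. -/
theorem disjoint_sums {R : Type*} [CommRing R] (h2 : (2 : R) = 0) {x₀ x₁ x₂ x₃ x₄ x₅ : R}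
    (n01 : x₀ ≠ x₁) (n02 : x₀ ≠ x₂) (n12 : x₁ ≠ x₂) (n34 : x₃ ≠ x₄) (n35 : x₃ ≠ x₅) (n45 : x₄ ≠ x₅)
    (n03 : x₀ ≠ x₃) (n04 : x₀ ≠ x₄) (n05 : x₀ ≠ x₅) (n13 : x₁ ≠ x₃) (n14 : x₁ ≠ x₄) (n15 : x₁ ≠ x₅)
    (n23 : x₂ ≠ x₃) (n24 : x₂ ≠ x₄) (n25 : x₂ ≠ x₅) (h : x₀ + x₁ + x₂ + x₃ + x₄ + x₅ = 0) :
    (x₁ + x₂ ≠ 0 ∧ x₀ + x₂ ≠ 0 ∧ x₁ + x₂ ≠ x₀ + x₂) ∧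
      (x₄ + x₅ ≠ 0 ∧ x₃ + x₅ ≠ 0 ∧ x₄ + x₅ ≠ x₃ + x₅) ∧
      ¬ (x₄ + x₅ = x₁ + x₂ ∨ x₄ + x₅ = x₀ + x₂ ∨ x₄ + x₅ = x₁ + x₂ + (x₀ + x₂)) ∧
      ¬ (x₃ + x₅ = x₁ + x₂ ∨ x₃ + x₅ = x₀ + x₂ ∨ x₃ + x₅ = x₁ + x₂ + (x₀ + x₂)) ∧
      ¬ (x₄ + x₅ + (x₃ + x₅) = x₁ + x₂ ∨ x₄ + x₅ + (x₃ + x₅) = x₀ + x₂ ∨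
        x₄ + x₅ + (x₃ + x₅) = x₁ + x₂ + (x₀ + x₂)) := by
  refine ⟨⟨?_, ?_, ?_⟩, ⟨?_, ?_, ?_⟩, ?_, ?_, ?_⟩ <;> grind

/-- Injective 6-tuples with vanishing sum and vanishing sum of `σ(x) x`, split into two triples
with a common sum. -/
theorem card_injective_six_tuples [CharP F 2] (σ : F →+* F) :
    (Finset.univ.filter fun f : Fin 6 → F => Function.Injective f ∧
        ∑ i, f i = 0 ∧ ∑ i, σ (f i) * f i = 0).card =
      Fintype.card F * ∑ p ∈ nondegPairs F, (partners σ p).card := by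
  have h2 : (2 : F) = 0 := CharTwo.two_eq_zero
  rw [← Finset.card_univ (α := F), ← Finset.card_sigma, ← Finset.card_product]
  refine Finset.card_nbij'
    (fun f => (f 0 + f 1 + f 2, ⟨(f 1 + f 2, f 0 + f 2), (f 4 + f 5, f 3 + f 5)⟩))
    (fun r => ![r.1 + r.2.1.1, r.1 + r.2.1.2, r.1 + (r.2.1.1 + r.2.1.2),
      r.1 + r.2.2.1, r.1 + r.2.2.2, r.1 + (r.2.2.1 + r.2.2.2)]) ?_ ?_ ?_ ?_
  · intro f hf
    rw [Finset.mem_coe, Finset.mem_filter, Fin.sum_univ_six, Fin.sum_univ_six] at hf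
    obtain ⟨-, hinj, h0, h1⟩ := hf
    have hne : ∀ i j, i ≠ j → f i ≠ f j := fun i j h h' => h (hinj h')
    have n01 := hne 0 1 (by decide)
    have n02 := hne 0 2 (by decide)
    have n12 := hne 1 2 (by decide)
    have n34 := hne 3 4 (by decide)
    have n35 := hne 3 5 (by decide)
    have n45 := hne 4 5 (by decide)
    have n03 := hne 0 3 (by decide)
    have n04 := hne 0 4 (by decide)
    have n05 := hne 0 5 (by decide)
    have n13 := hne 1 3 (by decide)
    have n14 := hne 1 4 (by decide)
    have n15 := hne 1 5 (by decide)
    have n23 := hne 2 3 (by decide)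
    have n24 := hne 2 4 (by decide)
    have n25 := hne 2 5 (by decide)
    clear hne hinj
    have e5 : f 5 = f 0 + f 1 + f 2 + f 3 + f 4 := by grind
    have e5' := congrArg σ e5
    simp only [map_add] at e5'
    simp only [Finset.mem_coe, Finset.mem_product, Finset.mem_univ, true_and, Finset.mem_sigma,
      nondegPairs, partners, polarFiber, tripleOf, Finset.mem_filter, Finset.mem_insert,
      Finset.mem_singleton, frobPolar, map_add]
    have hd := disjoint_sums h2 n01 n02 n12 n34 n35 n45 n03 n04 n05 n13 n14 n15 n23 n24 n25 h0
    refine ⟨hd.1, ?_, hd.2⟩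
    clear * - h0 h1 h2 e5 e5'
    grind
  · rintro ⟨s, ⟨u, v⟩, ⟨u', v'⟩⟩ hr
    simp only [Finset.mem_coe, Finset.mem_product, Finset.mem_univ, true_and, Finset.mem_sigma,
      nondegPairs, partners, polarFiber, tripleOf, Finset.mem_filter, Finset.mem_insert,
      Finset.mem_singleton] at hr
    rw [Finset.mem_coe, Finset.mem_filter, Fin.sum_univ_six, Fin.sum_univ_six]
    refine ⟨Finset.mem_univ _, ?_, ?_, ?_⟩
    · obtain ⟨h1, -, h3, h4⟩ := hr
      simp only [Function.Injective, Fin.forall_fin_succ]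
      simp
      grind
    · clear hr
      simp
      grind
    · have hB : frobPolar σ u' v' = frobPolar σ u v := hr.2.1
      clear hr
      simp [frobPolar] at hB ⊢
      grind
  · intro f hf
    rw [Finset.mem_coe, Finset.mem_filter, Fin.sum_univ_six] at hf
    have h0 := hf.2.2.1
    funext i
    fin_cases i <;> simp <;> grind
  · rintro ⟨s, ⟨u, v⟩, ⟨u', v'⟩⟩ -
    simp
    grind

end Tuples

section Field

theorem coprime_two_pow_add_one {m e : ℕ} (hm4 : m % 4 = 2) (hgcd : Nat.gcd m e = 2) :
    Nat.Coprime (2 ^ m - 1) (2 ^ e + 1) := by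
  have hg : Nat.gcd m (2 * e) = 2 := by
    obtain ⟨a, rfl⟩ : 2 ∣ m := by omega
    have he : 2 ∣ e := hgcd ▸ Nat.gcd_dvd_right _ _
    obtain ⟨b, rfl⟩ := he
    rw [Nat.gcd_mul_left] at hgcd ⊢
    have hab : Nat.Coprime a b := by unfold Nat.Coprime; omega
    have ha : Nat.Coprime a 2 := by
      rw [Nat.coprime_two_right, Nat.odd_iff]; omega
    rw [Nat.Coprime.gcd_eq_one (ha.mul_right hab)]
  have he : 2 ∣ e := hgcd ▸ Nat.gcd_dvd_right _ _
  have h1 := Nat.gcd_dvd_left (2 ^ m - 1) (2 ^ e + 1)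
  have h2 := Nat.gcd_dvd_right (2 ^ m - 1) (2 ^ e + 1)
  have h3 : Nat.gcd (2 ^ m - 1) (2 ^ e + 1) ∣ 2 ^ (2 * e) - 1 := by
    refine h2.trans ⟨2 ^ e - 1, ?_⟩
    rw [← Nat.sq_sub_sq, ← pow_mul, mul_comm e 2, one_pow]
  have h4 := Nat.dvd_gcd h1 h3
  rw [Nat.pow_sub_one_gcd_pow_sub_one, hg] at h4
  rcases (Nat.dvd_prime Nat.prime_three).1 h4 with h | h
  · exact h
  · exfalso
    rw [h] at h2
    obtain ⟨b, rfl⟩ := he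
    rw [pow_mul, Nat.dvd_iff_mod_eq_zero] at h2
    simp [Nat.add_mod, Nat.pow_mod] at h2

variable {F : Type*} [Field F] [Fintype F]

theorem pow_surjective_of_coprime {k : ℕ} (hk0 : k ≠ 0)
    (hk : Nat.Coprime (Fintype.card F - 1) k) (t : F) : ∃ c : F, c ^ k = t := by
  rcases eq_or_ne t 0 with rfl | ht
  · exact ⟨0, zero_pow hk0⟩
  · have hk' : (Nat.card Fˣ).Coprime k := by
      classical
      rwa [Nat.card_eq_fintype_card, Fintype.card_units]
    refine ⟨((powCoprime hk').symm (Units.mk0 t ht) : Fˣ), ?_⟩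
    have := (powCoprime hk').apply_symm_apply (Units.mk0 t ht)
    rw [powCoprime_apply] at this
    rw [← Units.val_pow_eq_pow_val, this, Units.val_mk0]

theorem exists_cube_root_of_unity [CharP F 2] (h3 : 3 ∣ Fintype.card F - 1) :
    ∃ ω : F, ω ^ 2 + ω + 1 = 0 := by
  classical
  have : Fact (Nat.Prime 3) := ⟨Nat.prime_three⟩
  rw [← Fintype.card_units] at h3
  obtain ⟨w, hw⟩ := exists_prime_orderOf_dvd_card 3 h3
  have hw3 : (w : F) ^ 3 = 1 := by
    rw [← Units.val_pow_eq_pow_val, ← hw, pow_orderOf_eq_one, Units.val_one]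
  have hw1 : (w : F) ≠ 1 := by
    intro h
    rw [Units.val_eq_one] at h
    simp [h] at hw
  refine ⟨w, mul_left_cancel₀ (sub_ne_zero.2 hw1) ?_⟩
  linear_combination hw3

theorem fixed_of_pow_two_pow [CharP F 2] {m e : ℕ} (hF : Fintype.card F = 2 ^ m)
    (hgcd : Nat.gcd m e = 2) {ω : F} (hω : ω ^ 2 + ω + 1 = 0) {x : F} (hx : x ^ 2 ^ e = x) :
    x = 0 ∨ x = 1 ∨ x = ω ∨ x = ω + 1 := by
  have h2 : (2 : F) = 0 := CharTwo.two_eq_zero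
  rcases eq_or_ne x 0 with h0 | h0
  · exact Or.inl h0
  have h1 : x ^ (2 ^ m - 1) = 1 := by rw [← hF]; exact FiniteField.pow_card_sub_one_eq_one x h0
  have h3 : x ^ (2 ^ e - 1) = 1 := by
    refine mul_right_cancel₀ h0 ?_
    rw [← pow_succ, Nat.sub_add_cancel Nat.one_le_two_pow, hx, one_mul]
  have h4 : x ^ 3 = 1 := by
    have := Nat.dvd_gcd (orderOf_dvd_of_pow_eq_one h1) (orderOf_dvd_of_pow_eq_one h3)
    rw [Nat.pow_sub_one_gcd_pow_sub_one, hgcd] at this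
    exact orderOf_dvd_iff_pow_eq_one.1 this
  have h5 : (x + 1) * ((x + ω) * (x + (ω + 1))) = 0 := by grind
  rcases mul_eq_zero.1 h5 with h | h
  · right; left; grind
  · rcases mul_eq_zero.1 h with h | h
    · right; right; left; grind
    · right; right; right; grind

end Field


/-- The number of 6-element subsets `B` of `F = GF(2^m)` with `∑_{g∈B} g = 0` and
`∑_{g∈B} g^{2^e+1} = 0` equals `2^m(2^m-1)(2^m-4)(2^m-24)/720`. -/
theorem card_weight6_supports (m : ℕ) (hm6 : 6 ≤ m) (hm4 : m % 4 = 2)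
    (e : ℕ) (he2 : 2 ≤ e) (hem : 2 * e ≤ m) (hgcd : Nat.gcd m e = 2)
    (F : Type) [Field F] [Fintype F] (hF : Fintype.card F = 2 ^ m) :
    Nat.card {B : Finset F // B.card = 6 ∧
        (∑ g ∈ B, g = 0) ∧ (∑ g ∈ B, g ^ (2 ^ e + 1) = 0)} =
      2 ^ m * (2 ^ m - 1) * (2 ^ m - 4) * (2 ^ m - 24) / 720 := by
  classical
  have he : 2 ∣ e := hgcd ▸ Nat.gcd_dvd_right _ _
  have : Fact (Nat.Prime 2) := ⟨Nat.prime_two⟩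
  have : CharP F 2 := charP_of_card_eq_prime_pow hF
  obtain ⟨ω, hω⟩ : ∃ ω : F, ω ^ 2 + ω + 1 = 0 := by
    refine exists_cube_root_of_unity ?_
    rw [hF]
    exact Nat.pow_sub_one_dvd_pow_sub_one 2 (show 2 ∣ m by omega)
  set σ : F →+* F := iterateFrobenius F 2 e with hσ
  have hσ_apply : ∀ x, σ x = x ^ 2 ^ e := fun x => iterateFrobenius_def 2 e x
  have hω3 : ω ^ 3 = 1 := by linear_combination (ω - 1) * hω
  have hσω : σ ω = ω := by
    obtain ⟨b, rfl⟩ := he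
    have h1 : 2 ^ (2 * b) % 3 = 1 := by
      rw [pow_mul]
      simp [Nat.pow_mod]
    rw [hσ_apply, ← Nat.div_add_mod (2 ^ (2 * b)) 3, h1, pow_add, pow_mul, hω3, one_pow, one_mul,
      pow_one]
  have hfix : ∀ x, σ x = x → x = 0 ∨ x = 1 ∨ x = ω ∨ x = ω + 1 := fun x hx =>
    fixed_of_pow_two_pow hF hgcd hω ((hσ_apply x).symm.trans hx)
  have hpow : ∀ x : F, x ^ (2 ^ e + 1) = σ x * x := fun x => by rw [hσ_apply, pow_succ]
  have hsurj : ∀ t : F, ∃ c, σ c * c = t := fun t => by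
    obtain ⟨c, hc⟩ := pow_surjective_of_coprime (Nat.succ_ne_zero (2 ^ e))
      (by rw [hF]; exact coprime_two_pow_add_one hm4 hgcd) t
    exact ⟨c, (hpow c).symm.trans hc⟩
  have hq : 28 ≤ Fintype.card F := by
    rw [hF]
    exact le_trans (by norm_num) (Nat.pow_le_pow_right two_pos hm6)
  have h1 := card_injective_tuples (α := F) 6
    fun B => ∑ g ∈ B, g = 0 ∧ ∑ g ∈ B, g ^ (2 ^ e + 1) = 0
  have h2 := card_injective_six_tuples σ
  rw [sum_card_partners hω hσω hfix hsurj hq, hF] at h2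
  have h3 : (Finset.univ.filter fun f : Fin 6 → F => Function.Injective f ∧
        ∑ i, f i = 0 ∧ ∑ i, σ (f i) * f i = 0) =
      Finset.univ.filter fun f : Fin 6 → F => Function.Injective f ∧
        (∑ g ∈ Finset.univ.image f, g = 0 ∧
          ∑ g ∈ Finset.univ.image f, g ^ (2 ^ e + 1) = 0) := by
    refine Finset.filter_congr fun f _ => and_congr_right fun hf => ?_
    rw [Finset.sum_image hf.injOn, Finset.sum_image hf.injOn]
    simp only [hpow]
  rw [h3, h1] at h2
  rw [Nat.card_eq_fintype_card, Fintype.card_subtype]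
  refine Nat.eq_div_of_mul_eq_left (by norm_num) ?_
  rw [show (720 : ℕ) = Nat.factorial 6 by rfl, h2]
  ring
end

section
/- Let m ≥ 6 with m ≡ 2 (mod 4), and let e be an integer with 2 ≤ e ≤ m/2 and gcd(m,e) = 2. Then the number of 8-element subsets B of F = GF(2^m) with ∑_{g∈B} g = 0 and ∑_{g∈B} g^{2^e+1} = 0 equals 2^m(2^m−1)(2^m−4)(2^{3m} − 23·2^{2m} + 344·2^m − 1612)/40320. -/
open Finset

/-- Newton's identities in degree eight for a family of signs, all of whose power sums are
the cardinality or the sum of the family. -/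
theorem sum_powersetCard_eight_prod_of_sq_eq_one {ι : Type*} [Fintype ι] (ε : ι → ℚ)
    (hε : ∀ i, ε i ^ 2 = 1) :
    40320 * ∑ B ∈ powersetCard 8 (univ : Finset ι), ∏ i ∈ B, ε i =
      (∑ i, ε i) ^ 8 + (112 - 28 * (Fintype.card ι : ℚ)) * (∑ i, ε i) ^ 6 +
      (210 * (Fintype.card ι : ℚ) ^ 2 - 1540 * Fintype.card ι + 2464) * (∑ i, ε i) ^ 4 +
      (-420 * (Fintype.card ι : ℚ) ^ 3 + 4200 * (Fintype.card ι : ℚ) ^ 2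
        - 11872 * Fintype.card ι + 8448) * (∑ i, ε i) ^ 2 +
      (105 * (Fintype.card ι : ℚ) ^ 4 - 1260 * (Fintype.card ι : ℚ) ^ 3
        + 4620 * (Fintype.card ι : ℚ) ^ 2 - 5040 * Fintype.card ι) := by
  have newton (k : ℕ) :
      (k : ℚ) * ∑ B ∈ powersetCard k (univ : Finset ι), ∏ i ∈ B, ε i =
        (-1) ^ (k + 1) * ∑ a ∈ antidiagonal k with a.1 < k, (-1) ^ a.1 *
          (∑ B ∈ powersetCard a.1 (univ : Finset ι), ∏ i ∈ B, ε i) * ∑ i, ε i ^ a.2 := by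
    have h := congrArg (MvPolynomial.aeval ε) (MvPolynomial.mul_esymm_eq_sum ι ℚ k)
    simpa [MvPolynomial.esymm, MvPolynomial.psum] using h
  have even (k : ℕ) : ∑ i, ε i ^ (2 * k) = Fintype.card ι := by
    simp [pow_mul, hε]
  have odd (k : ℕ) : ∑ i, ε i ^ (2 * k + 1) = ∑ i, ε i := by
    simp [pow_succ, pow_mul, hε]
  have p2 := even 1
  have p4 := even 2
  have p6 := even 3
  have p8 := even 4
  have p3 := odd 1
  have p5 := odd 2
  have p7 := odd 3
  norm_num at p2 p3 p4 p5 p6 p7 p8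
  have h1 := newton 1
  have h2 := newton 2
  have h3 := newton 3
  have h4 := newton 4
  have h5 := newton 5
  have h6 := newton 6
  have h7 := newton 7
  have h8 := newton 8
  simp only [sum_filter, Nat.sum_antidiagonal_eq_sum_range_succ_mk, sum_range_succ,
    range_zero, sum_empty] at h1 h2 h3 h4 h5 h6 h7 h8
  norm_num [p2, p3, p4, p5, p6, p7, p8] at h1 h2 h3 h4 h5 h6 h7 h8
  generalize (Fintype.card ι : ℚ) = q at *
  generalize ∑ i, ε i = S at *
  generalize ∑ B ∈ powersetCard 8 (univ : Finset ι), ∏ i ∈ B, ε i = e8 at *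
  generalize ∑ B ∈ powersetCard 7 (univ : Finset ι), ∏ i ∈ B, ε i = e7 at *
  generalize ∑ B ∈ powersetCard 6 (univ : Finset ι), ∏ i ∈ B, ε i = e6 at *
  generalize ∑ B ∈ powersetCard 5 (univ : Finset ι), ∏ i ∈ B, ε i = e5 at *
  generalize ∑ B ∈ powersetCard 4 (univ : Finset ι), ∏ i ∈ B, ε i = e4 at *
  generalize ∑ B ∈ powersetCard 3 (univ : Finset ι), ∏ i ∈ B, ε i = e3 at *
  generalize ∑ B ∈ powersetCard 2 (univ : Finset ι), ∏ i ∈ B, ε i = e2 at *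
  clear newton even odd p2 p3 p4 p5 p6 p7 p8
  have solve {k x y : ℚ} (hk : k ≠ 0) (h : k * x = y) : x = y / k := by
    rw [eq_div_iff hk, mul_comm, h]
  obtain rfl := solve (by norm_num) h2
  obtain rfl := solve (by norm_num) h3
  obtain rfl := solve (by norm_num) h4
  obtain rfl := solve (by norm_num) h5
  obtain rfl := solve (by norm_num) h6
  obtain rfl := solve (by norm_num) h7
  obtain rfl := solve (by norm_num) h8
  rw [h1]
  ring

theorem addChar_map_sum {ι A M : Type*} [AddCommMonoid A] [CommMonoid M] (ψ : AddChar A M)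
    (s : Finset ι) (f : ι → A) : ψ (∑ i ∈ s, f i) = ∏ i ∈ s, ψ (f i) :=
  map_prod ψ.toMonoidHom (fun i ↦ Multiplicative.ofAdd (f i)) s

section FiniteField

variable {F : Type*} [Field F]

theorem apply_pow_two_pow {ψ : AddChar F ℚ} {e : ℕ} (hfrob : ∀ x, ψ (x ^ 2) = ψ x)
    (x : F) : ψ (x ^ 2 ^ e) = ψ x := by
  induction e with
  | zero => simp
  | succ k ih => rw [pow_succ, pow_mul, hfrob, ih]

theorem apply_gold_add {ψ : AddChar F ℚ} {e : ℕ} [CharP F 2] (a b x u : F) :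
    ψ (a * (x + u) ^ (2 ^ e + 1) + b * (x + u)) =
      ψ (a * x ^ (2 ^ e + 1) + b * x) * ψ (a * u ^ (2 ^ e + 1) + b * u) *
        ψ (a * (x ^ 2 ^ e * u + u ^ 2 ^ e * x)) := by
  rw [← AddChar.map_add_eq_mul, ← AddChar.map_add_eq_mul, pow_succ (x + u), add_pow_char_pow]
  congr 1
  ring

variable [Fintype F]

/-- A finite field of characteristic two has a primitive additive sign character that is invariant
under squaring. -/
theorem exists_isPrimitive_addChar_rat_of_charTwo [CharP F 2] :
    ∃ ψ : AddChar F ℚ, ψ.IsPrimitive ∧ (∀ x, ψ x ^ 2 = 1) ∧ ∀ x, ψ (x ^ 2) = ψ x := by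
  let _ : Algebra (ZMod 2) F := ZMod.algebra F 2
  have hζ : (-1 : ℚ) ^ 2 = 1 := by norm_num
  let ψ : AddChar F ℚ :=
    (AddChar.zmodChar 2 hζ).compAddMonoidHom (Algebra.trace (ZMod 2) F).toAddMonoidHom
  have hψ (x : F) : ψ x = (-1) ^ (Algebra.trace (ZMod 2) F x).val := rfl
  refine ⟨ψ, fun a ha h ↦ ?_, fun x ↦ ?_, fun x ↦ ?_⟩
  · refine ha ((traceForm_nondegenerate (ZMod 2) F).1 a fun b ↦ ?_)
    have hb : ψ (a * b) = 1 := by simpa using DFunLike.congr_fun h b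
    rw [hψ] at hb
    rw [Algebra.traceForm_apply]
    generalize Algebra.trace (ZMod 2) F (a * b) = t at hb
    fin_cases t
    · rfl
    · norm_num [ZMod.val] at hb
  · rw [hψ, ← pow_mul, mul_comm, pow_mul, hζ, one_pow]
  · rw [hψ, hψ]
    have h := Algebra.trace_eq_of_algEquiv (FiniteField.frobeniusAlgEquivOfAlgebraic (ZMod 2) F) x
    simp only [FiniteField.coe_frobeniusAlgEquivOfAlgebraic, ZMod.card] at h
    rw [h]

theorem card_filter_pow_four_eq_self [DecidableEq F] (h3 : 3 ∣ Fintype.card F - 1) :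
    #{v : F | v ^ 4 = v} = 4 := by
  obtain ⟨ζ, hζ⟩ : ∃ ζ : Fˣ, orderOf ζ = 3 := by
    refine exists_prime_orderOf_dvd_card 3 ?_
    rwa [Fintype.card_units]
  have hz : IsPrimitiveRoot (ζ : F) 3 :=
    IsPrimitiveRoot.coe_units_iff.mpr (hζ ▸ IsPrimitiveRoot.orderOf ζ)
  have h1 := hz.ne_one (by norm_num)
  have h0 : (ζ : F) ≠ 0 := ζ.ne_zero
  have hs : (ζ : F) ^ 2 + ζ + 1 = 0 := by
    have := hz.pow_eq_one
    have : ((ζ : F) - 1) * ((ζ : F) ^ 2 + ζ + 1) = 0 := by linear_combination this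
    exact (mul_eq_zero.mp this).resolve_left (sub_ne_zero.mpr h1)
  have key : ({v : F | v ^ 4 = v} : Finset F) = {0, 1, (ζ : F), (ζ : F) ^ 2} := by
    ext v
    have : v ^ 4 - v = v * ((v - 1) * ((v - ζ) * (v - (ζ : F) ^ 2))) := by
      linear_combination (v ^ 3 - v ^ 2 * ζ + v * (ζ - 1)) * hs
    simp only [mem_filter, mem_univ, true_and, mem_insert, mem_singleton]
    rw [← sub_eq_zero, this]
    simp [sub_eq_zero]
  rw [key]
  have h2 : (ζ : F) ≠ ζ ^ 2 := fun h ↦ h1 (mul_left_cancel₀ h0 (by linear_combination -h))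
  have h3 : (1 : F) ≠ ζ ^ 2 := fun h ↦ hz.pow_ne_one_of_pos_of_lt (l := 2)
    (by norm_num) (by norm_num) h.symm
  rw [card_insert_of_notMem, card_insert_of_notMem, card_insert_of_notMem, card_singleton]
  · simpa using h2
  · simpa using ⟨h1.symm, h3⟩
  · simpa using ⟨h0.symm, (pow_ne_zero 2 h0).symm⟩

theorem pow_two_pow_eq_self_iff {m k : ℕ} (hF : Fintype.card F = 2 ^ m) (hk : Nat.gcd k m = 2)
    (v : F) : v ^ 2 ^ k = v ↔ v ^ 4 = v := by
  have iter (j : ℕ) : (fun x : F ↦ x ^ 2)^[j] v = v ^ 2 ^ j := by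
    simp [pow_iterate]
  have hper (j : ℕ) : Function.IsPeriodicPt (fun x : F ↦ x ^ 2) j v ↔ v ^ 2 ^ j = v := by
    rw [Function.IsPeriodicPt, Function.IsFixedPt, iter]
  have h2 : v ^ 4 = v ↔ Function.IsPeriodicPt (fun x : F ↦ x ^ 2) 2 v := by
    rw [hper]; norm_num
  rw [h2, ← hper]
  refine ⟨fun h ↦ ?_, fun h ↦ h.trans_dvd (hk ▸ Nat.gcd_dvd_left k m)⟩
  have hm : Function.IsPeriodicPt (fun x : F ↦ x ^ 2) m v := by
    rw [hper, ← hF, FiniteField.pow_card]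
  exact hk ▸ h.gcd hm

/-- The elements `u` satisfying the linearized equation that defines the radical of the
polarization of `x ↦ Tr (a * x ^ (2 ^ e + 1))`. -/
def goldRadical [DecidableEq F] (e : ℕ) (a : F) : Finset F :=
  {u : F | a * u = (a * u ^ 2 ^ e) ^ 2 ^ e}

theorem add_mem_goldRadical [DecidableEq F] [CharP F 2] {e : ℕ} {a u v : F}
    (hu : u ∈ goldRadical e a) (hv : v ∈ goldRadical e a) : u + v ∈ goldRadical e a := by
  simp only [goldRadical, mem_filter, mem_univ, true_and] at *
  rw [mul_add, hu, hv, add_pow_char_pow, mul_add, add_pow_char_pow]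

theorem surjective_pow_of_coprime {n : ℕ} (hn : n ≠ 0)
    (h : (Fintype.card F - 1).Coprime n) :
    Function.Surjective fun x : F ↦ x ^ n := by
  classical
  intro a
  by_cases ha : a = 0
  · exact ⟨0, by simp [ha, hn]⟩
  · have h' : (Nat.card Fˣ).Coprime n := by
      rwa [Nat.card_eq_fintype_card, Fintype.card_units]
    obtain ⟨c, hc⟩ := (powCoprime h').surjective (Units.mk0 a ha)
    refine ⟨c, ?_⟩
    have := congrArg Units.val hc
    simpa using this

theorem card_goldRadical [DecidableEq F] [CharP F 2] {m e : ℕ} (hF : Fintype.card F = 2 ^ m)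
    (hgcd : Nat.gcd (e + e) m = 2) (h3 : 3 ∣ Fintype.card F - 1)
    (hcop : (Fintype.card F - 1).Coprime (2 ^ e + 1)) {a : F} (ha : a ≠ 0) :
    #(goldRadical e a) = 4 := by
  obtain ⟨c, hc⟩ := surjective_pow_of_coprime (F := F) (Nat.succ_ne_zero _) hcop a
  simp only at hc
  rw [Nat.succ_eq_add_one] at hc
  have hc0 : c ≠ 0 := by
    rintro rfl
    simp at hc
    exact ha hc.symm
  rw [← card_filter_pow_four_eq_self h3]
  refine card_bij' (fun u _ ↦ c * u) (fun v _ ↦ c⁻¹ * v) ?_ ?_ ?_ ?_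
  · intro u hu
    simp only [goldRadical, mem_filter, mem_univ, true_and] at *
    rw [← pow_two_pow_eq_self_iff hF hgcd]
    have hcn : c ^ 2 ^ e ≠ 0 := pow_ne_zero _ hc0
    refine mul_left_cancel₀ hcn ?_
    simp only [← hc, pow_succ _ (2 ^ e), mul_pow] at hu
    rw [pow_add, pow_mul, mul_pow, mul_pow]
    linear_combination -hu
  · intro v hv
    simp only [goldRadical, mem_filter, mem_univ, true_and] at *
    rw [← pow_two_pow_eq_self_iff hF hgcd] at hv
    rw [← hc]
    have hv' : (v ^ 2 ^ e) ^ 2 ^ e = v := by rw [← pow_mul, ← pow_add, hv]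
    simp only [pow_succ _ (2 ^ e), mul_pow, inv_pow, hv']
    field_simp
  · intro u _; field_simp
  · intro u _; field_simp

section QuadraticSum

variable {ψ : AddChar F ℚ} {e : ℕ}

/-- The sum of a sign character over the values of `x ↦ a * x ^ (2 ^ e + 1) + b * x`. -/
def goldSum (ψ : AddChar F ℚ) (e : ℕ) (a b : F) : ℚ :=
  ∑ x, ψ (a * x ^ (2 ^ e + 1) + b * x)

theorem exists_polar_eq_mul [DecidableEq F] [CharP F 2] (hfrob : ∀ x, ψ (x ^ 2) = ψ x)
    (e : ℕ) (a u : F) : ∃ w : F, (w = 0 ↔ u ∈ goldRadical e a) ∧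
      ∀ x, ψ (a * (x ^ 2 ^ e * u + u ^ 2 ^ e * x)) = ψ (x * w) := by
  obtain ⟨r, hr⟩ : ∃ r : F, r ^ 2 ^ e = a * u :=
    (bijective_iterateFrobenius (R := F) (p := 2) e).surjective (a * u)
  refine ⟨r + a * u ^ 2 ^ e, ?_, fun x ↦ ?_⟩
  · simp only [goldRadical, mem_filter, mem_univ, true_and]
    rw [CharTwo.add_eq_zero, ← hr]
    exact ⟨fun h ↦ h ▸ rfl, fun h ↦ iterateFrobenius_inj F 2 e h⟩
  · have h1 : a * (x ^ 2 ^ e * u + u ^ 2 ^ e * x) = (x * r) ^ 2 ^ e + x * (a * u ^ 2 ^ e) := by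
      rw [mul_pow, hr]; ring
    rw [h1, mul_add, AddChar.map_add_eq_mul, AddChar.map_add_eq_mul, apply_pow_two_pow hfrob]

theorem goldSum_sq [DecidableEq F] [CharP F 2] (hprim : ψ.IsPrimitive)
    (hsq : ∀ x, ψ x ^ 2 = 1) (hfrob : ∀ x, ψ (x ^ 2) = ψ x) (a b : F) :
    goldSum ψ e a b ^ 2 =
      Fintype.card F * ∑ u ∈ goldRadical e a, ψ (a * u ^ (2 ^ e + 1) + b * u) := by
  have h (x : F) : goldSum ψ e a b = ∑ u, ψ (a * (x + u) ^ (2 ^ e + 1) + b * (x + u)) :=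
    (Equiv.sum_comp (Equiv.addLeft x) fun y ↦ ψ (a * y ^ (2 ^ e + 1) + b * y)).symm
  calc goldSum ψ e a b ^ 2
      = ∑ x, ψ (a * x ^ (2 ^ e + 1) + b * x) *
          ∑ u, ψ (a * (x + u) ^ (2 ^ e + 1) + b * (x + u)) := by
        rw [sq]
        nth_rw 1 [goldSum]
        rw [sum_mul]
        exact sum_congr rfl fun x _ ↦ by rw [← h x]
    _ = ∑ u, ψ (a * u ^ (2 ^ e + 1) + b * u) *
          ∑ x, ψ (a * (x ^ 2 ^ e * u + u ^ 2 ^ e * x)) := by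
        simp_rw [mul_sum]
        rw [sum_comm]
        refine sum_congr rfl fun u _ ↦ sum_congr rfl fun x _ ↦ ?_
        rw [apply_gold_add, mul_assoc, ← mul_assoc, ← sq, hsq, one_mul]
    _ = ∑ u, ψ (a * u ^ (2 ^ e + 1) + b * u) *
          if u ∈ goldRadical e a then (Fintype.card F : ℚ) else 0 := by
        refine sum_congr rfl fun u _ ↦ ?_
        obtain ⟨w, hw, hψ⟩ := exists_polar_eq_mul hfrob e a u
        simp_rw [hψ, AddChar.sum_mulShift w hprim, hw]
        push_cast
        rfl
    _ = _ := by
        simp only [mul_ite, mul_zero, ← sum_filter, mul_sum, filter_mem_eq_inter, univ_inter]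
        exact sum_congr rfl fun u _ ↦ mul_comm _ _

theorem sum_goldRadical_sq [DecidableEq F] [CharP F 2] (hfrob : ∀ x, ψ (x ^ 2) = ψ x)
    (a b : F) : (∑ u ∈ goldRadical e a, ψ (a * u ^ (2 ^ e + 1) + b * u)) ^ 2 =
      #(goldRadical e a) * ∑ u ∈ goldRadical e a, ψ (a * u ^ (2 ^ e + 1) + b * u) := by
  rw [sq, sum_mul_sum, ← nsmul_eq_mul, ← sum_const]
  refine sum_congr rfl fun u hu ↦ ?_
  refine sum_bij' (fun v _ ↦ v + u) (fun v _ ↦ v + u)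
    (fun v hv ↦ add_mem_goldRadical hv hu) (fun v hv ↦ add_mem_goldRadical hv hu)
    (fun v _ ↦ CharTwo.add_cancel_right v u) (fun v _ ↦ CharTwo.add_cancel_right v u) ?_
  intro v _
  obtain ⟨w, hw, hψ⟩ := exists_polar_eq_mul hfrob e a u
  rw [apply_gold_add, hψ, hw.mpr hu, mul_zero, AddChar.map_zero_eq_one, mul_one, mul_comm]

theorem sum_goldSum_sq [DecidableEq F] [CharP F 2] (hprim : ψ.IsPrimitive)
    (hsq : ∀ x, ψ x ^ 2 = 1) (hfrob : ∀ x, ψ (x ^ 2) = ψ x) (a : F) :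
    ∑ b, goldSum ψ e a b ^ 2 = (Fintype.card F : ℚ) ^ 2 := by
  have h0 : (0 : F) ∈ goldRadical e a := by simp [goldRadical]
  simp_rw [goldSum_sq hprim hsq hfrob, AddChar.map_add_eq_mul]
  rw [← mul_sum, sum_comm]
  simp_rw [← mul_sum, AddChar.sum_mulShift _ hprim]
  simp [h0, sq]

theorem goldSum_pow_four [DecidableEq F] [CharP F 2] (hprim : ψ.IsPrimitive)
    (hsq : ∀ x, ψ x ^ 2 = 1) (hfrob : ∀ x, ψ (x ^ 2) = ψ x) {a : F}
    (ha : #(goldRadical e a) = 4) (b : F) :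
    goldSum ψ e a b ^ 4 = 4 * Fintype.card F * goldSum ψ e a b ^ 2 := by
  rw [show goldSum ψ e a b ^ 4 = (goldSum ψ e a b ^ 2) ^ 2 by ring,
    goldSum_sq hprim hsq hfrob, mul_pow, sum_goldRadical_sq hfrob, ha]
  push_cast
  ring

theorem goldSum_zero_left [DecidableEq F] (hprim : ψ.IsPrimitive) (b : F) :
    goldSum ψ e 0 b = if b = 0 then (Fintype.card F : ℚ) else 0 := by
  simp_rw [goldSum, zero_mul, zero_add, mul_comm b, AddChar.sum_mulShift b hprim]
  push_cast
  rfl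

end QuadraticSum

theorem sum_sum_prod_eq_card_sq_mul_card [DecidableEq F] {ψ : AddChar F ℚ}
    (hprim : ψ.IsPrimitive) (k n : ℕ) :
    ∑ a, ∑ b, ∑ B ∈ powersetCard k (univ : Finset F), ∏ g ∈ B, ψ (a * g ^ n + b * g) =
      (Fintype.card F : ℚ) ^ 2 *
        Nat.card {B : Finset F // #B = k ∧ ∑ g ∈ B, g = 0 ∧ ∑ g ∈ B, g ^ n = 0} := by
  have hprod (a b : F) (B : Finset F) : ∏ g ∈ B, ψ (a * g ^ n + b * g) =
      ψ (a * ∑ g ∈ B, g ^ n) * ψ (b * ∑ g ∈ B, g) := by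
    rw [← AddChar.map_add_eq_mul, mul_sum, mul_sum, ← sum_add_distrib,
      addChar_map_sum]
  have hcard : Nat.card {B : Finset F // #B = k ∧ ∑ g ∈ B, g = 0 ∧ ∑ g ∈ B, g ^ n = 0} =
      #{B ∈ powersetCard k (univ : Finset F) | ∑ g ∈ B, g = 0 ∧ ∑ g ∈ B, g ^ n = 0} := by
    rw [Nat.card_eq_fintype_card, Fintype.card_subtype]
    congr 1
    ext B
    simp [mem_powersetCard]
  calc _ = ∑ B ∈ powersetCard k (univ : Finset F),
        (∑ a, ψ (a * ∑ g ∈ B, g ^ n)) * ∑ b, ψ (b * ∑ g ∈ B, g) := by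
        simp_rw [hprod, sum_mul_sum]
        simp_rw [sum_comm (s := univ) (t := powersetCard k (univ : Finset F))]
    _ = _ := by
        simp_rw [AddChar.sum_mulShift _ hprim]
        rw [hcard, card_filter]
        push_cast
        rw [mul_sum]
        refine sum_congr rfl fun B _ ↦ ?_
        split_ifs <;> simp_all [sq]

end FiniteField

theorem three_dvd_two_pow_sub_one {m : ℕ} (hm : Even m) : 3 ∣ 2 ^ m - 1 := by
  obtain ⟨k, rfl⟩ := hm
  have := Nat.sub_dvd_pow_sub_pow 4 1 k
  rwa [one_pow, show 4 = 2 ^ 2 by rfl, ← pow_mul, two_mul, show 2 ^ 2 - 1 = 3 by rfl] at this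

theorem coprime_two_pow_sub_one_two_pow_add_one {m e : ℕ} (he : Even e)
    (hgcd : Nat.gcd (e + e) m = 2) : (2 ^ m - 1).Coprime (2 ^ e + 1) := by
  have h3 : Nat.gcd (2 ^ m - 1) (2 ^ e + 1) ∣ 3 := by
    have h : Nat.gcd (2 ^ (e + e) - 1) (2 ^ m - 1) = 3 := by
      rw [Nat.pow_sub_one_gcd_pow_sub_one, hgcd]
      rfl
    rw [← h, Nat.dvd_gcd_iff]
    refine ⟨(Nat.gcd_dvd_right _ _).trans ⟨2 ^ e - 1, ?_⟩, Nat.gcd_dvd_left _ _⟩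
    rw [← Nat.sq_sub_sq, pow_add, sq, one_pow]
  refine ((Nat.dvd_prime Nat.prime_three).mp h3).resolve_right fun h ↦ ?_
  have h1 : 3 ∣ 2 ^ e + 1 := h ▸ Nat.gcd_dvd_right _ _
  have h2 := three_dvd_two_pow_sub_one he
  have := Nat.one_le_two_pow (n := e)
  omega

/-- The number of 8-element subsets `B` of `F = GF(2^m)` with `∑_{g∈B} g = 0` and
`∑_{g∈B} g^{2^e+1} = 0` equals
`2^m(2^m-1)(2^m-4)(2^{3m} - 23·2^{2m} + 344·2^m - 1612)/40320`. -/
theorem card_weight8_supports (m : ℕ) (hm6 : 6 ≤ m) (hm4 : m % 4 = 2)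
    (e : ℕ) (he2 : 2 ≤ e) (hem : 2 * e ≤ m) (hgcd : Nat.gcd m e = 2)
    (F : Type) [Field F] [Fintype F] (hF : Fintype.card F = 2 ^ m) :
    Nat.card {B : Finset F // B.card = 8 ∧
        (∑ g ∈ B, g = 0) ∧ (∑ g ∈ B, g ^ (2 ^ e + 1) = 0)} =
      2 ^ m * (2 ^ m - 1) * (2 ^ m - 4) *
        (2 ^ (3 * m) - 23 * 2 ^ (2 * m) + 344 * 2 ^ m - 1612) / 40320 := by
  classical
  have : CharP F 2 := charP_of_card_eq_prime_pow hF
  have he : Even e := even_iff_two_dvd.mpr (hgcd ▸ Nat.gcd_dvd_right m e)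
  have hgcd' : Nat.gcd (e + e) m = 2 := by
    obtain ⟨k, rfl⟩ : ∃ k, m = 2 * k := ⟨m / 2, by omega⟩
    obtain ⟨l, rfl⟩ := he.two_dvd
    have hkl : Nat.gcd k l = 1 := by
      rw [Nat.gcd_mul_left] at hgcd
      omega
    have hk : Nat.Coprime 4 k :=
      Nat.Coprime.pow_left 2 ((Nat.coprime_two_left (n := k)).mpr (Nat.odd_iff.mpr (by omega)))
    rw [show 2 * l + 2 * l = 2 * (2 * l) by ring, Nat.gcd_mul_left]
    have h2 : Nat.Coprime 2 k := hk.coprime_dvd_left (by norm_num)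
    rw [Nat.Coprime.gcd_mul_left_cancel l h2, Nat.gcd_comm, hkl]
  have h3 : 3 ∣ Fintype.card F - 1 := by
    rw [hF]
    exact three_dvd_two_pow_sub_one (Nat.even_iff.mpr (by omega))
  have hcop : (Fintype.card F - 1).Coprime (2 ^ e + 1) := by
    rw [hF]
    exact coprime_two_pow_sub_one_two_pow_add_one he hgcd'
  obtain ⟨ψ, hprim, hsq, hfrob⟩ := exists_isPrimitive_addChar_rat_of_charTwo (F := F)
  have hcount := sum_sum_prod_eq_card_sq_mul_card hprim 8 (2 ^ e + 1)
  set N := Nat.card {B : Finset F // #B = 8 ∧ ∑ g ∈ B, g = 0 ∧ ∑ g ∈ B, g ^ (2 ^ e + 1) = 0}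
  have hnewton (a b : F) := sum_powersetCard_eight_prod_of_sq_eq_one
    (fun x ↦ ψ (a * x ^ (2 ^ e + 1) + b * x)) fun x ↦ hsq _
  simp only [← goldSum.eq_def] at hnewton
  obtain ⟨q, hq⟩ : ∃ q : ℚ, q = Fintype.card F := ⟨_, rfl⟩
  have hq0 : q ≠ 0 := by simp [hq]
  rw [← hq] at hcount
  simp only [← hq] at hnewton
  have hrow (a : F) (ha : a ≠ 0) :
      ∑ b, 40320 * ∑ B ∈ powersetCard 8 (univ : Finset F),
          ∏ g ∈ B, ψ (a * g ^ (2 ^ e + 1) + b * g) =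
        q ^ 2 * (64 * q ^ 3 + (112 - 28 * q) * (16 * q ^ 2)
          + (210 * q ^ 2 - 1540 * q + 2464) * (4 * q)
          + (-420 * q ^ 3 + 4200 * q ^ 2 - 11872 * q + 8448))
        + q * (105 * q ^ 4 - 1260 * q ^ 3 + 4620 * q ^ 2 - 5040 * q) := by
    have h2 := sum_goldSum_sq (e := e) hprim hsq hfrob a
    have h4 (b : F) := goldSum_pow_four hprim hsq hfrob (card_goldRadical hF hgcd' h3 hcop ha) b
    simp only [← hq] at h2 h4
    calc _ = ∑ b, (goldSum ψ e a b ^ 2 * (64 * q ^ 3 + (112 - 28 * q) * (16 * q ^ 2)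
          + (210 * q ^ 2 - 1540 * q + 2464) * (4 * q)
          + (-420 * q ^ 3 + 4200 * q ^ 2 - 11872 * q + 8448))
        + (105 * q ^ 4 - 1260 * q ^ 3 + 4620 * q ^ 2 - 5040 * q)) := by
          refine sum_congr rfl fun b _ ↦ ?_
          rw [hnewton]
          linear_combination (goldSum ψ e a b ^ 4 + 4 * q * goldSum ψ e a b ^ 2 + 16 * q ^ 2
            + (112 - 28 * q) * (goldSum ψ e a b ^ 2 + 4 * q)
            + (210 * q ^ 2 - 1540 * q + 2464)) * h4 b
      _ = _ := by
          rw [sum_add_distrib, ← sum_mul, h2, sum_const, nsmul_eq_mul, card_univ, ← hq]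
  have hzero : ∑ b, 40320 * ∑ B ∈ powersetCard 8 (univ : Finset F),
          ∏ g ∈ B, ψ (0 * g ^ (2 ^ e + 1) + b * g) =
        q ^ 8 + (112 - 28 * q) * q ^ 6 + (210 * q ^ 2 - 1540 * q + 2464) * q ^ 4
          + (-420 * q ^ 3 + 4200 * q ^ 2 - 11872 * q + 8448) * q ^ 2
        + q * (105 * q ^ 4 - 1260 * q ^ 3 + 4620 * q ^ 2 - 5040 * q) := by
    simp_rw [hnewton, goldSum_zero_left hprim, ← hq]
    simp only [ite_pow, sum_add_distrib, ← mul_sum, sum_ite_eq', mem_univ, if_true, sum_const,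
      card_univ, nsmul_eq_mul, ← hq, ne_eq, OfNat.ofNat_ne_zero, not_false_eq_true, zero_pow]
  have htotal : 40320 * (q ^ 2 * N) =
      q ^ 2 * (q * (q - 1) * (q - 4) * (q ^ 3 - 23 * q ^ 2 + 344 * q - 1612)) := by
    rw [← hcount, mul_sum]
    simp_rw [mul_sum (s := (univ : Finset F))]
    rw [← add_sum_erase _ _ (mem_univ (0 : F)), hzero,
      sum_congr rfl fun a ha ↦ hrow a (ne_of_mem_erase ha), sum_const, nsmul_eq_mul,
      card_erase_of_mem (mem_univ _), card_univ, Nat.cast_sub Fintype.card_pos, ← hq]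
    push_cast
    ring
  have hN : 40320 * (N : ℚ) = q * (q - 1) * (q - 4) * (q ^ 3 - 23 * q ^ 2 + 344 * q - 1612) :=
    mul_left_cancel₀ (pow_ne_zero 2 hq0) (by linear_combination htotal)
  have hQ : 64 ≤ 2 ^ m := (by norm_num : 64 = 2 ^ 6) ▸ Nat.pow_le_pow_right two_pos hm6
  rw [hF] at hq
  rw [mul_comm 3 m, mul_comm 2 m, pow_mul, pow_mul]
  generalize 2 ^ m = Q at *
  refine (Nat.div_eq_of_eq_mul_right (by norm_num) ?_).symm
  have hcube : 23 * Q ^ 2 ≤ Q ^ 3 := by nlinarith [sq_nonneg (Q : ℤ)]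
  have hlin : 1612 ≤ Q ^ 3 - 23 * Q ^ 2 + 344 * Q := by omega
  have : ((Q * (Q - 1) * (Q - 4) * (Q ^ 3 - 23 * Q ^ 2 + 344 * Q - 1612) : ℕ) : ℚ) =
      ((40320 * N : ℕ) : ℚ) := by
    push_cast [Nat.cast_sub hlin, Nat.cast_sub hcube, Nat.cast_sub (show 1 ≤ Q by omega),
      Nat.cast_sub (show 4 ≤ Q by omega)]
    rw [hN, hq]
  exact_mod_cast this
end

section
/- Let m ≥ 3 and let E be a nonempty set of integers with E ⊆ {1, 2, …, ⌊m/2⌋}. Then for every integer k there exists an integer λ such that for every 2-element subset {x,y} of F = GF(2^m), the number of subsets B of F with |B| = k, |B| even, {x,y} ⊆ B, ∑_{g∈B} g = 0, and ∑_{g∈B} g^{2^e+1} = 0 for all e ∈ E, equals λ. That is, for each k the supports of the weight-k codewords of C̄_E form the blocks of a 2-design on the point set F. -/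
theorem charP_two_of_card_eq_two_pow {F : Type*} [Field F] [Fintype F] {m : ℕ}
    (hF : Fintype.card F = 2 ^ m) : CharP F 2 := by
  obtain ⟨p, hp⟩ := CharP.exists F
  have hprime : p.Prime := (CharP.char_is_prime_or_zero F p).resolve_right
    (CharP.char_ne_zero_of_finite F p)
  have hzero : (2 : F) ^ m = 0 := by
    simpa [hF] using Nat.cast_card_eq_zero F
  have hdvd : p ∣ 2 :=
    (CharP.cast_eq_zero_iff F p 2).mp (by simpa using eq_zero_of_pow_eq_zero hzero)
  rwa [(Nat.prime_dvd_prime_iff_eq hprime Nat.prime_two).mp hdvd] at hp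

theorem exists_affine_map_pair {F : Type*} [Field F] {x y x' y' : F}
    (h : x ≠ y) (h' : x' ≠ y') :
    ∃ a b : F, a ≠ 0 ∧ a * x + b = x' ∧ a * y + b = y' := by
  have hxy : y - x ≠ 0 := sub_ne_zero.mpr h.symm
  refine ⟨(y' - x') / (y - x), x' - (y' - x') / (y - x) * x,
    div_ne_zero (sub_ne_zero.mpr h'.symm) hxy, by ring, ?_⟩
  field_simp
  ring

section Affine

variable {F : Type*} [Field F] [CharP F 2]

theorem natCast_eq_zero_of_even {n : ℕ} (hn : Even n) : (n : F) = 0 :=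
  (CharP.cast_eq_zero_iff F 2 n).mpr hn.two_dvd

theorem sum_affine_eq_zero {B : Finset F} (hB : Even B.card) (hsum : ∑ g ∈ B, g = 0) (a b : F) :
    ∑ g ∈ B, (a * g + b) = 0 := by
  rw [Finset.sum_add_distrib, ← Finset.mul_sum, hsum]
  simp [natCast_eq_zero_of_even hB]

theorem sum_affine_pow_eq_zero {B : Finset F} (hB : Even B.card) (hsum : ∑ g ∈ B, g = 0) {e : ℕ}
    (hpow : ∑ g ∈ B, g ^ (2 ^ e + 1) = 0) (a b : F) :
    ∑ g ∈ B, (a * g + b) ^ (2 ^ e + 1) = 0 := by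
  have hfrob : ∑ g ∈ B, g ^ 2 ^ e = 0 := by
    rw [← sum_pow_char_pow 2 e, hsum, zero_pow (by positivity)]
  have hexpand (g : F) : (a * g + b) ^ (2 ^ e + 1) =
      a ^ (2 ^ e + 1) * g ^ (2 ^ e + 1) + a ^ 2 ^ e * b * g ^ 2 ^ e + b ^ 2 ^ e * a * g +
        b ^ (2 ^ e + 1) := by
    rw [pow_succ, add_pow_char_pow, mul_pow]
    ring
  simp only [hexpand, Finset.sum_add_distrib]
  rw [← Finset.mul_sum, ← Finset.mul_sum, ← Finset.mul_sum, hsum, hpow, hfrob]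
  simp [natCast_eq_zero_of_even hB]

theorem card_codeword_supports_le [Finite F] (E : Finset ℕ) (k : ℕ) {x y x' y' : F}
    (h : x ≠ y) (h' : x' ≠ y') :
    Nat.card {B : Finset F // B.card = k ∧ Even B.card ∧ x ∈ B ∧ y ∈ B ∧
      (∑ g ∈ B, g = 0) ∧ ∀ e ∈ E, ∑ g ∈ B, g ^ (2 ^ e + 1) = 0} ≤
    Nat.card {B : Finset F // B.card = k ∧ Even B.card ∧ x' ∈ B ∧ y' ∈ B ∧
      (∑ g ∈ B, g = 0) ∧ ∀ e ∈ E, ∑ g ∈ B, g ^ (2 ^ e + 1) = 0} := by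
  obtain ⟨a, b, ha, rfl, rfl⟩ := exists_affine_map_pair h h'
  let φ : F ↪ F := ⟨fun g => a * g + b, (add_left_injective b).comp (mul_right_injective₀ ha)⟩
  refine Nat.card_le_card_of_injective (fun B => ⟨B.1.map φ, ?_⟩) ?_
  · obtain ⟨B, hk, hB, hx, hy, hsum, hpow⟩ := B
    refine ⟨by simpa using hk, by simpa using hB, Finset.mem_map_of_mem φ hx,
      Finset.mem_map_of_mem φ hy, ?_, fun e he => ?_⟩
    · exact (Finset.sum_map B φ _).trans <| sum_affine_eq_zero hB hsum a b
    · exact (Finset.sum_map B φ _).trans <| sum_affine_pow_eq_zero hB hsum (hpow e he) a b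
  · intro B C hBC
    exact Subtype.ext (Finset.map_injective φ (congrArg Subtype.val hBC))

end Affine

/-- For each `k`, the supports of the weight-`k` codewords of the extended cyclic code
`C̄_E` (i.e. the `k`-element subsets `B` of `F = GF(2^m)` of even cardinality with
`∑_{g∈B} g = 0` and `∑_{g∈B} g^{2^e+1} = 0` for all `e ∈ E`) form the blocks of a
2-design on `F`: there is a `λ` such that every 2-element subset `{x,y}` of `F` is
contained in exactly `λ` of these subsets. -/
theorem extended_code_holds_2designs (m : ℕ) (hm : 3 ≤ m)
    (E : Finset ℕ) (hE : E.Nonempty) (hEsub : ∀ e ∈ E, 1 ≤ e ∧ 2 * e ≤ m)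
    (F : Type) [Field F] [Fintype F] (hF : Fintype.card F = 2 ^ m) (k : ℕ) :
    ∃ lam : ℕ, ∀ x y : F, x ≠ y →
      Nat.card {B : Finset F // B.card = k ∧ Even B.card ∧ x ∈ B ∧ y ∈ B ∧
        (∑ g ∈ B, g = 0) ∧ ∀ e ∈ E, ∑ g ∈ B, g ^ (2 ^ e + 1) = 0} = lam := by
  have := charP_two_of_card_eq_two_pow hF
  exact ⟨_, fun x y hxy => le_antisymm
    (card_codeword_supports_le E k hxy zero_ne_one)
    (card_codeword_supports_le E k zero_ne_one hxy)⟩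
end

section
/- Let m ≥ 3 and let E be a nonempty set of integers with E ⊆ {1, 2, …, ⌊m/2⌋}. Let C_E be the 𝔽₂-vector space of all functions c : F∖{0} → 𝔽₂ such that ∑_{g≠0} ι(c(g))·g = 0 and, for every e ∈ E, ∑_{g≠0} ι(c(g))·g^{2^e+1} = 0 in F. Then the 𝔽₂-dimension of C_E equals 2^m − 1 − (2|E|+1)m/2 if m is even and m/2 ∈ E, and equals 2^m − 1 − (|E|+1)m otherwise. -/
noncomputable local instance (m : ℕ) : Fintype (GaloisField 2 m) := Fintype.ofFinite _
attribute [local instance] Classical.propDecidable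

/-- The linear functional `c ↦ ∑_{g ≠ 0} ι(c(g))·g^s` on functions from the nonzero
elements of `GF(2^m)` to `𝔽₂`, where `ι : 𝔽₂ → GF(2^m)` is the unique ring
homomorphism. -/
noncomputable def phiStar (m s : ℕ) :
    ({x : GaloisField 2 m // x ≠ 0} → ZMod 2) →ₗ[ZMod 2] GaloisField 2 m where
  toFun c := ∑ g, algebraMap (ZMod 2) (GaloisField 2 m) (c g) * (g : GaloisField 2 m) ^ s
  map_add' c d := by simp [add_mul, Finset.sum_add_distrib]
  map_smul' a c := by simp [Algebra.smul_def, mul_assoc, Finset.mul_sum]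

/-- The binary code `C_E` of length `2^m - 1`: all functions `c : GF(2^m)∖{0} → 𝔽₂`
with `∑_{g≠0} ι(c(g))·g = 0` and `∑_{g≠0} ι(c(g))·g^{2^e+1} = 0` for all `e ∈ E`. -/
noncomputable def codeCE (m : ℕ) (E : Finset ℕ) :
    Submodule (ZMod 2) ({x : GaloisField 2 m // x ≠ 0} → ZMod 2) :=
  LinearMap.ker (phiStar m 1) ⊓ ⨅ e ∈ E, LinearMap.ker (phiStar m (2 ^ e + 1))

section FiniteFieldCharTwo

variable {K : Type*} [Field K] [Algebra (ZMod 2) K]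

/-- The `k`-th iterate of the Frobenius plus the identity, as an `𝔽₂`-linear map. -/
noncomputable def frobeniusPowAddId (K : Type*) [Field K] [Algebra (ZMod 2) K] (k : ℕ) :
    K →ₗ[ZMod 2] K where
  toFun x := x ^ 2 ^ k + x
  map_add' x y := by
    have : CharP K 2 := charP_of_injective_algebraMap (algebraMap (ZMod 2) K).injective 2
    rw [add_pow_char_pow]; ring
  map_smul' a x := by
    have h : a ^ 2 ^ k = a := ZMod.pow_card_pow a
    simp only [Algebra.smul_def, mul_pow, ← map_pow, h, RingHom.id_apply]
    ring

variable [Finite K]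

theorem trace_pow_two_pow (k : ℕ) (x : K) :
    Algebra.trace (ZMod 2) K (x ^ 2 ^ k) = Algebra.trace (ZMod 2) K x := by
  induction k with
  | zero => simp
  | succ k ih =>
    rw [pow_succ, pow_mul, ← ih]
    have h := Algebra.trace_eq_of_algEquiv
      (FiniteField.frobeniusAlgEquivOfAlgebraic (ZMod 2) K) (x ^ 2 ^ k)
    simpa [FiniteField.coe_frobeniusAlgEquivOfAlgebraic, ZMod.card] using h

theorem eq_zero_of_forall_trace_mul_eq_zero {x : K}
    (h : ∀ y, Algebra.trace (ZMod 2) K (x * y) = 0) : x = 0 :=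
  (traceForm_nondegenerate (ZMod 2) K).1 x h

theorem finrank_ker_frobeniusPowAddId {k : ℕ} (hk : 1 ≤ k)
    (hK : Module.finrank (ZMod 2) K = 2 * k) :
    Module.finrank (ZMod 2) (LinearMap.ker (frobeniusPowAddId K k)) = k ∧
      LinearMap.range (frobeniusPowAddId K k) = LinearMap.ker (frobeniusPowAddId K k) := by
  have : CharP K 2 := charP_of_injective_algebraMap (algebraMap (ZMod 2) K).injective 2
  have := Fintype.ofFinite K
  have hcard : Fintype.card K = 2 ^ (2 * k) := by
    rw [Module.card_eq_pow_finrank (K := ZMod 2), ZMod.card, hK]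
  have hle : LinearMap.range (frobeniusPowAddId K k) ≤ LinearMap.ker (frobeniusPowAddId K k) := by
    rintro _ ⟨x, rfl⟩
    change (x ^ 2 ^ k + x) ^ 2 ^ k + (x ^ 2 ^ k + x) = 0
    have hx : (x ^ 2 ^ k) ^ 2 ^ k = x := by
      rw [← pow_mul, ← pow_add, ← two_mul, ← hcard, FiniteField.pow_card]
    rw [add_pow_char_pow, hx]
    linear_combination (x ^ 2 ^ k + x) * CharTwo.two_eq_zero (R := K)
  have hsum := LinearMap.finrank_range_add_finrank_ker (frobeniusPowAddId K k)
  have hle' := Submodule.finrank_mono hle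
  have hub : Module.finrank (ZMod 2) (LinearMap.ker (frobeniusPowAddId K k)) ≤ k := by
    rw [← Nat.pow_le_pow_iff_right (one_lt_two)]
    have h1 : Nat.card (LinearMap.ker (frobeniusPowAddId K k)) =
        2 ^ Module.finrank (ZMod 2) (LinearMap.ker (frobeniusPowAddId K k)) := by
      rw [Module.natCard_eq_pow_finrank (K := ZMod 2), Nat.card_zmod]
    rw [← h1]
    have hone : 1 < 2 ^ k := Nat.one_lt_two_pow (by omega)
    have hdeg : (Polynomial.X ^ 2 ^ k - Polynomial.X : Polynomial K).natDegree = 2 ^ k :=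
      FiniteField.X_pow_card_sub_X_natDegree_eq K hone
    have hne := FiniteField.X_pow_card_sub_X_ne_zero K hone
    have hsub : ((LinearMap.ker (frobeniusPowAddId K k) : Submodule (ZMod 2) K) : Set K) ⊆
        (Polynomial.X ^ 2 ^ k - Polynomial.X : Polynomial K).roots.toFinset := by
      intro x hx
      have hx' : x ^ 2 ^ k + x = 0 := hx
      exact Multiset.mem_toFinset.2 (Polynomial.mem_roots'.2
        ⟨hne, by simp [CharTwo.sub_eq_add, hx']⟩)
    calc Nat.card (LinearMap.ker (frobeniusPowAddId K k))
        ≤ (Polynomial.X ^ 2 ^ k - Polynomial.X : Polynomial K).roots.toFinset.card := by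
          rw [← Set.ncard_coe_finset]
          exact Set.ncard_le_ncard hsub (Finset.finite_toSet _)
      _ ≤ _ := (Multiset.toFinset_card_le _).trans (Polynomial.card_roots' _)
      _ = 2 ^ k := hdeg
  refine ⟨by omega, Submodule.eq_of_le_of_finrank_le hle (by omega)⟩

theorem trace_eq_zero_of_pow_two_pow_eq {k : ℕ} (hk : 1 ≤ k)
    (hK : Module.finrank (ZMod 2) K = 2 * k) {x : K} (hx : x ^ 2 ^ k + x = 0) :
    Algebra.trace (ZMod 2) K x = 0 := by
  have hx' : x ∈ LinearMap.range (frobeniusPowAddId K k) := by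
    rw [(finrank_ker_frobeniusPowAddId hk hK).2]; exact hx
  obtain ⟨w, rfl⟩ := hx'
  change Algebra.trace (ZMod 2) K (w ^ 2 ^ k + w) = 0
  rw [map_add, trace_pow_two_pow, CharTwo.add_self_eq_zero]

/-- If the quadratic function `x ↦ Tr(b x + ∑ aₑ x^(2^e+1))` vanishes, then so does the linearized
polynomial of its polar form. -/
theorem polar_eq_zero {m : ℕ} (hK : Module.finrank (ZMod 2) K = m) {E : Finset ℕ}
    (hE : ∀ e ∈ E, e ≤ m) {b : K} {a : E → K}
    (h : ∀ x : K, Algebra.trace (ZMod 2) K (b * x + ∑ e, a e * x ^ (2 ^ (e : ℕ) + 1)) = 0)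
    (x : K) : ∑ e : E, (a e * x ^ 2 ^ (e : ℕ) + (a e * x) ^ 2 ^ (m - e)) = 0 := by
  have : CharP K 2 := charP_of_injective_algebraMap (algebraMap (ZMod 2) K).injective 2
  have := Fintype.ofFinite K
  have hcard : Fintype.card K = 2 ^ m := by
    rw [Module.card_eq_pow_finrank (K := ZMod 2), ZMod.card, hK]
  refine eq_zero_of_forall_trace_mul_eq_zero fun y ↦ ?_
  have key : Algebra.trace (ZMod 2) K
      (∑ e : E, (a e * x ^ 2 ^ (e : ℕ) * y + a e * x * y ^ 2 ^ (e : ℕ))) = 0 := by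
    have hxy := h (x + y)
    have hsplit : b * (x + y) + ∑ e, a e * (x + y) ^ (2 ^ (e : ℕ) + 1) =
        (b * x + ∑ e, a e * x ^ (2 ^ (e : ℕ) + 1)) + (b * y + ∑ e, a e * y ^ (2 ^ (e : ℕ) + 1)) +
        ∑ e : E, (a e * x ^ 2 ^ (e : ℕ) * y + a e * x * y ^ 2 ^ (e : ℕ)) := by
      have : ∀ e : E, a e * (x + y) ^ (2 ^ (e : ℕ) + 1) = a e * x ^ (2 ^ (e : ℕ) + 1) +
          a e * y ^ (2 ^ (e : ℕ) + 1) +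
          (a e * x ^ 2 ^ (e : ℕ) * y + a e * x * y ^ 2 ^ (e : ℕ)) := fun e ↦ by
        rw [pow_succ (x + y), add_pow_char_pow]; ring
      simp only [this, Finset.sum_add_distrib]
      ring
    rwa [hsplit, map_add, map_add, h x, h y, zero_add, zero_add] at hxy
  rw [← key, Finset.sum_mul, map_sum, map_sum]
  refine Finset.sum_congr rfl fun e _ ↦ ?_
  rw [add_mul, map_add, map_add, ← trace_pow_two_pow (m - e) (a e * x * y ^ 2 ^ (e : ℕ)),
    mul_pow (a e * x), ← pow_mul y, ← pow_add, Nat.add_sub_cancel' (hE e e.2), ← hcard,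
    FiniteField.pow_card]

open Polynomial in
theorem coeff_of_polar_eq_zero {m : ℕ} (hK : Module.finrank (ZMod 2) K = m) {E : Finset ℕ}
    (hE : ∀ e ∈ E, 1 ≤ e ∧ 2 * e ≤ m) {a : E → K}
    (h : ∀ x : K, ∑ e : E, (a e * x ^ 2 ^ (e : ℕ) + (a e * x) ^ 2 ^ (m - e)) = 0) (e : E) :
    if 2 * (e : ℕ) = m then a e ^ 2 ^ (e : ℕ) + a e = 0 else a e = 0 := by
  have := Fintype.ofFinite K
  have hcard : Fintype.card K = 2 ^ m := by
    rw [Module.card_eq_pow_finrank (K := ZMod 2), ZMod.card, hK]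
  set P : K[X] := ∑ e : E, (C (a e) * X ^ 2 ^ (e : ℕ) +
    C (a e ^ 2 ^ (m - e)) * X ^ 2 ^ (m - e)) with hP
  have hdeg : P.natDegree < Fintype.card K := by
    rw [hcard]
    have hle : P.natDegree ≤ 2 ^ (m - 1) := by
      refine natDegree_sum_le_of_forall_le _ _ fun i _ ↦ ?_
      have hi := hE i i.2
      refine natDegree_add_le_of_degree_le ?_ ?_ <;>
      exact (natDegree_C_mul_X_pow_le _ _).trans (Nat.pow_le_pow_right two_pos (by omega))
    have hi := hE e e.2
    exact hle.trans_lt (Nat.pow_lt_pow_right one_lt_two (by omega))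
  have hzero : P = 0 := by
    refine eq_zero_of_natDegree_lt_card_of_eval_eq_zero P Function.injective_id (fun x ↦ ?_) hdeg
    rw [← h x, hP, eval_finsetSum]
    simp [mul_pow]
  have hcoeff : P.coeff (2 ^ (e : ℕ)) = a e + if 2 * (e : ℕ) = m then a e ^ 2 ^ (e : ℕ) else 0 := by
    have hi := hE e e.2
    rw [hP, finsetSum_coeff]
    simp only [coeff_add, coeff_C_mul_X_pow, Finset.sum_add_distrib,
      Nat.pow_right_injective le_rfl |>.eq_iff]
    congr 1
    · rw [Finset.sum_eq_single e] <;> simp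
      intro e' he' hne h'
      exact absurd h'.symm hne
    · rw [Finset.sum_eq_single e]
      · by_cases h2 : 2 * (e : ℕ) = m
        · rw [if_pos (by omega), if_pos h2, show m - e = e by omega]
        · rw [if_neg (by omega), if_neg h2]
      · intro e' _ hne
        have hi' := hE e' e'.2
        have : (e' : ℕ) ≠ e := fun h' ↦ hne (Subtype.ext h')
        exact if_neg (by omega)
      · simp
  rw [hzero, coeff_zero] at hcoeff
  split_ifs with h2
  · rw [if_pos h2] at hcoeff
    rw [add_comm, ← hcoeff]
  · rw [if_neg h2, add_zero] at hcoeff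
    exact hcoeff.symm

theorem forall_trace_eq_zero_iff {m : ℕ} (hK : Module.finrank (ZMod 2) K = m) {E : Finset ℕ}
    (hE : ∀ e ∈ E, 1 ≤ e ∧ 2 * e ≤ m) {b : K} {a : E → K} :
    (∀ x : K, Algebra.trace (ZMod 2) K (b * x + ∑ e, a e * x ^ (2 ^ (e : ℕ) + 1)) = 0) ↔
      b = 0 ∧ ∀ e : E, if 2 * (e : ℕ) = m then a e ^ 2 ^ (e : ℕ) + a e = 0 else a e = 0 := by
  have hcase : (∀ e : E, if 2 * (e : ℕ) = m then a e ^ 2 ^ (e : ℕ) + a e = 0 else a e = 0) →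
      ∀ x, Algebra.trace (ZMod 2) K (∑ e, a e * x ^ (2 ^ (e : ℕ) + 1)) = 0 := by
    have := Fintype.ofFinite K
    have hcard : Fintype.card K = 2 ^ m := by
      rw [Module.card_eq_pow_finrank (K := ZMod 2), ZMod.card, hK]
    intro h x
    rw [map_sum]
    refine Finset.sum_eq_zero fun e _ ↦ ?_
    have he := h e
    split_ifs at he with h2
    · refine trace_eq_zero_of_pow_two_pow_eq (hE e e.2).1 (hK.trans h2.symm) ?_
      have hx : (x ^ 2 ^ (e : ℕ)) ^ 2 ^ (e : ℕ) = x := by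
        rw [← pow_mul, ← pow_add, ← two_mul, h2, ← hcard, FiniteField.pow_card]
      rw [pow_succ, mul_pow, mul_pow, hx]
      linear_combination x * x ^ 2 ^ (e : ℕ) * he
    · simp [he]
  constructor
  · intro h
    have ha := coeff_of_polar_eq_zero hK hE
      (polar_eq_zero hK (fun e he ↦ by have := hE e he; omega) h)
    refine ⟨eq_zero_of_forall_trace_mul_eq_zero fun y ↦ ?_, ha⟩
    have hy := h y
    rwa [map_add, hcase ha, add_zero] at hy
  · rintro ⟨rfl, ha⟩ x
    rw [zero_mul, zero_add, hcase ha]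

end FiniteFieldCharTwo

/-- The trace description of the dual code of `C_E`: the coefficients `(b, a)` are sent to the word
`g ↦ Tr(b g + ∑ aₑ g^(2^e+1))`. -/
noncomputable def traceWord (m : ℕ) (E : Finset ℕ) :
    (GaloisField 2 m × (E → GaloisField 2 m)) →ₗ[ZMod 2]
      ({x : GaloisField 2 m // x ≠ 0} → ZMod 2) where
  toFun p g := Algebra.trace (ZMod 2) (GaloisField 2 m)
    (p.1 * (g : GaloisField 2 m) + ∑ e, p.2 e * (g : GaloisField 2 m) ^ (2 ^ (e : ℕ) + 1))
  map_add' p q := by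
    ext g
    simp only [Prod.fst_add, Prod.snd_add, Pi.add_apply, add_mul, Finset.sum_add_distrib, map_add]
    ring
  map_smul' c p := by
    ext g
    simp only [Prod.smul_fst, Prod.smul_snd, Pi.smul_apply, smul_mul_assoc, ← Finset.smul_sum,
      ← smul_add, map_smul, RingHom.id_apply]

theorem dotProduct_traceWord (m : ℕ) (E : Finset ℕ)
    (p : GaloisField 2 m × (E → GaloisField 2 m)) (c : {x : GaloisField 2 m // x ≠ 0} → ZMod 2) :
    traceWord m E p ⬝ᵥ c = Algebra.trace (ZMod 2) (GaloisField 2 m)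
      (p.1 * phiStar m 1 c + ∑ e : E, p.2 e * phiStar m (2 ^ (e : ℕ) + 1) c) := by
  have h : ∀ g, traceWord m E p g * c g = Algebra.trace (ZMod 2) (GaloisField 2 m)
      (p.1 * (algebraMap (ZMod 2) (GaloisField 2 m) (c g) * (g : GaloisField 2 m) ^ 1) +
        ∑ e : E, p.2 e * (algebraMap (ZMod 2) (GaloisField 2 m) (c g) *
          (g : GaloisField 2 m) ^ (2 ^ (e : ℕ) + 1))) := fun g ↦ by
    rw [mul_comm, ← smul_eq_mul]
    change c g • Algebra.trace (ZMod 2) (GaloisField 2 m) _ = _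
    rw [← map_smul, Algebra.smul_def, mul_add, Finset.mul_sum, pow_one]
    congr 2
    · ring
    · exact Finset.sum_congr rfl fun e _ ↦ by ring
  simp only [dotProduct, h, phiStar, LinearMap.coe_mk, AddHom.coe_mk]
  rw [← map_sum, Finset.sum_add_distrib, Finset.mul_sum, Finset.sum_comm]
  simp only [Finset.mul_sum]

theorem mem_codeCE_iff {m : ℕ} {E : Finset ℕ} {c : {x : GaloisField 2 m // x ≠ 0} → ZMod 2} :
    c ∈ codeCE m E ↔ ∀ p, traceWord m E p ⬝ᵥ c = 0 := by
  have hc : c ∈ codeCE m E ↔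
      phiStar m 1 c = 0 ∧ ∀ e : E, phiStar m (2 ^ (e : ℕ) + 1) c = 0 := by
    simp [codeCE, Submodule.mem_iInf]
  simp only [hc, dotProduct_traceWord]
  constructor
  · rintro ⟨h1, h2⟩ p
    simp [h1, h2]
  · intro h
    refine ⟨eq_zero_of_forall_trace_mul_eq_zero fun y ↦ ?_,
      fun e ↦ eq_zero_of_forall_trace_mul_eq_zero fun y ↦ ?_⟩
    · simpa [mul_comm] using h (y, 0)
    · have := h (0, Pi.single e y)
      simpa [Pi.single_apply, ite_mul, mul_comm] using this

theorem finrank_codeCE_add_finrank_range (m : ℕ) (hm : m ≠ 0) (E : Finset ℕ) :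
    Module.finrank (ZMod 2) (codeCE m E) +
      Module.finrank (ZMod 2) (LinearMap.range (traceWord m E)) = 2 ^ m - 1 := by
  set W := LinearMap.range (traceWord m E)
  let B : LinearMap.BilinForm (ZMod 2) ({x : GaloisField 2 m // x ≠ 0} → ZMod 2) :=
    dotProductBilin (ZMod 2) (ZMod 2)
  have hB : B.IsRefl := fun x y h ↦ by
    change y ⬝ᵥ x = 0
    rw [dotProduct_comm]; exact h
  have hnd : B.Nondegenerate := by
    refine (LinearMap.IsRefl.nondegenerate_iff_separatingLeft hB).2 fun x hx ↦ ?_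
    exact dotProduct_eq_zero x hx
  have hcode : codeCE m E = B.orthogonal W := by
    ext c
    rw [mem_codeCE_iff, LinearMap.BilinForm.mem_orthogonal_iff]
    constructor
    · rintro h _ ⟨p, rfl⟩
      exact h p
    · exact fun h p ↦ h _ ⟨p, rfl⟩
  have h := LinearMap.BilinForm.finrank_orthogonal hnd W
  have hle := Submodule.finrank_le W
  rw [← hcode] at h
  have hcard : Fintype.card {x : GaloisField 2 m // x ≠ 0} = 2 ^ m - 1 := by
    rw [Fintype.card_subtype_compl, Fintype.card_subtype_eq, ← Nat.card_eq_fintype_card,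
      GaloisField.card 2 m hm]
  rw [Module.finrank_pi, hcard] at h hle
  omega

theorem mem_ker_traceWord_iff {m : ℕ} (hm : m ≠ 0) {E : Finset ℕ}
    (hE : ∀ e ∈ E, 1 ≤ e ∧ 2 * e ≤ m) {p : GaloisField 2 m × (E → GaloisField 2 m)} :
    p ∈ LinearMap.ker (traceWord m E) ↔ p.1 = 0 ∧
      ∀ e : E, if 2 * (e : ℕ) = m then p.2 e ^ 2 ^ (e : ℕ) + p.2 e = 0 else p.2 e = 0 := by
  rw [← forall_trace_eq_zero_iff (GaloisField.finrank 2 hm) hE, LinearMap.mem_ker, funext_iff]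
  constructor
  · intro h x
    by_cases hx : x = 0
    · simp [hx]
    · exact h ⟨x, hx⟩
  · exact fun h g ↦ h g

theorem finrank_ker_traceWord {m : ℕ} (hm : m ≠ 0) {E : Finset ℕ}
    (hE : ∀ e ∈ E, 1 ≤ e ∧ 2 * e ≤ m) :
    Module.finrank (ZMod 2) (LinearMap.ker (traceWord m E)) =
      if Even m ∧ m / 2 ∈ E then m / 2 else 0 := by
  split_ifs with h
  · obtain ⟨⟨k, hk⟩, hkE⟩ := h
    obtain rfl : m = 2 * k := by omega
    rw [Nat.mul_div_cancel_left k two_pos] at hkE ⊢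
    let i : GaloisField 2 (2 * k) →ₗ[ZMod 2]
        (GaloisField 2 (2 * k) × (E → GaloisField 2 (2 * k))) :=
      LinearMap.inr _ _ _ ∘ₗ LinearMap.single (ZMod 2) (fun _ ↦ GaloisField 2 (2 * k)) ⟨k, hkE⟩
    have hi : Function.Injective i :=
      LinearMap.inr_injective.comp (Pi.single_injective (M := fun _ ↦ GaloisField 2 (2 * k)) (⟨k, hkE⟩ : E))
    have hker : LinearMap.ker (traceWord (2 * k) E) =
        (LinearMap.ker (frobeniusPowAddId (GaloisField 2 (2 * k)) k)).map i := by
      ext ⟨b, a⟩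
      rw [mem_ker_traceWord_iff hm hE, Submodule.mem_map]
      constructor
      · rintro ⟨rfl : b = 0, h⟩
        refine ⟨a ⟨k, hkE⟩, by simpa [frobeniusPowAddId] using h ⟨k, hkE⟩, Prod.ext rfl (funext fun e ↦ ?_)⟩
        change (Pi.single (⟨k, hkE⟩ : E) (a ⟨k, hkE⟩) : E → _) e = a e
        by_cases he : e = ⟨k, hkE⟩
        · subst he; simp
        · have hne : (e : ℕ) ≠ k := fun h' ↦ he (Subtype.ext h')
          have := h e
          rw [if_neg (by omega)] at this
          simpa [he] using this.symm
      · rintro ⟨x, hx, hxp⟩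
        obtain ⟨rfl, rfl⟩ := Prod.ext_iff.1 hxp
        refine ⟨rfl, fun e ↦ ?_⟩
        change if _ then (Pi.single (⟨k, hkE⟩ : E) x : E → _) e ^ _ +
          (Pi.single (⟨k, hkE⟩ : E) x : E → _) e = 0 else
          (Pi.single (⟨k, hkE⟩ : E) x : E → _) e = 0
        by_cases he : e = ⟨k, hkE⟩
        · subst he
          simpa [frobeniusPowAddId] using hx
        · simp [he]
    rw [hker, ← LinearEquiv.finrank_eq (Submodule.equivMapOfInjective i hi _)]
    exact (finrank_ker_frobeniusPowAddId (by omega) (GaloisField.finrank 2 hm)).1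
  · rw [Submodule.finrank_eq_zero, Submodule.eq_bot_iff]
    intro p hp
    obtain ⟨h1, h2⟩ := (mem_ker_traceWord_iff hm hE).1 hp
    refine Prod.ext h1 (funext fun e ↦ ?_)
    have he := h2 e
    rwa [if_neg] at he
    rintro rfl
    exact h ⟨even_two_mul _, by simp⟩

/-- The dimension of the binary cyclic code `C_E` is `2^m - 1 - (2|E|+1)m/2` if `m` is
even and `m/2 ∈ E`, and `2^m - 1 - (|E|+1)m` otherwise. -/
theorem dim_codeCE (m : ℕ) (hm : 3 ≤ m)
    (E : Finset ℕ) (hE : E.Nonempty) (hEsub : ∀ e ∈ E, 1 ≤ e ∧ 2 * e ≤ m) :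
    Module.finrank (ZMod 2) (codeCE m E) =
      if Even m ∧ m / 2 ∈ E then 2 ^ m - 1 - (2 * E.card + 1) * m / 2
      else 2 ^ m - 1 - (E.card + 1) * m := by
  have hm0 : m ≠ 0 := by omega
  have h1 := finrank_codeCE_add_finrank_range m hm0 E
  have h2 := LinearMap.finrank_range_add_finrank_ker (traceWord m E)
  rw [finrank_ker_traceWord hm0 hEsub, Module.finrank_prod, Module.finrank_pi_fintype,
    Finset.sum_const, GaloisField.finrank 2 hm0, Finset.card_univ, Fintype.card_coe,
    smul_eq_mul] at h2
  have h3 : (E.card + 1) * m = m + E.card * m := by ring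
  split_ifs at h2 ⊢ with h
  · obtain ⟨k, hk⟩ := h.1
    have h4 : (2 * E.card + 1) * m / 2 = E.card * m + k := by
      rw [hk]
      exact Nat.div_eq_of_eq_mul_right two_pos (by ring)
    omega
  · omega
end
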